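/- Comparison principle for the KPZ equation with unbounded data (classical version): let V satisfy the standing assumptions, ν, λ > 0, T > 0. Let U̲, Ū : [0,T] × ℝ^d → ℝ be continuous, C¹ in time and C² in space on (0,T] × ℝ^d, with ∂ₜU̲ ≤ νΔU̲ + λV(∇U̲) and ∂ₜŪ ≥ νΔŪ + λV(∇Ū) pointwise on (0,T] × ℝ^d, with U̲(0,·) ≤ Ū(0,·), and such that for every x ∈ ℝ^d, sup_{t∈[0,T]} (e^{2λ|U̲(t,·)|})*(x) < ∞ and sup_{t∈[0,T]} (e^{2λ|Ū(t,·)|})*(x) < ∞. Then U̲ ≤ Ū on [0,T] × ℝ^d. -/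

import Mathlib

open MeasureTheory Real Set
open scoped ENNReal

noncomputable section

/-- The Laplacian of a function `f : ℝ^d → ℝ` at `x`, as the trace of the second derivative. -/
def lapl {d : ℕ} (f : EuclideanSpace ℝ (Fin d) → ℝ) (x : EuclideanSpace ℝ (Fin d)) : ℝ :=
  ∑ i : Fin d,
    iteratedFDeriv ℝ 2 f x ![EuclideanSpace.single i (1:ℝ), EuclideanSpace.single i (1:ℝ)]

/-- Standing assumptions on the deposition rate `V` (with radial profile `W`):
`V` is `C²`, isotropic, convex, `W 0 = 0`, `W ≥ 0` and `W y ≤ y²` on `[0,∞)`. -/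
structure IsDepositionRate (d : ℕ) (V : EuclideanSpace ℝ (Fin d) → ℝ) (W : ℝ → ℝ) : Prop where
  smooth : ContDiff ℝ 2 V
  isotropic : ∀ p, V p = W ‖p‖
  convex : ConvexOn ℝ Set.univ V
  zero : W 0 = 0
  nonneg : ∀ y : ℝ, 0 ≤ y → 0 ≤ W y
  quadGrowth : ∀ y : ℝ, 0 ≤ y → W y ≤ y ^ 2

/-- The pointwise maximal heat quantity
`f*(x) = sup_{τ>0} ∫ (2πτ)^{-d/2} e^{-|x-y|²/(2τ)} |f(y)| dy ∈ [0,∞]`. -/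
def fstar {d : ℕ} (f : EuclideanSpace ℝ (Fin d) → ℝ)
    (x : EuclideanSpace ℝ (Fin d)) : ℝ≥0∞ :=
  ⨆ τ ∈ Set.Ioi (0:ℝ),
    ∫⁻ y, ENNReal.ofReal ((2 * π * τ) ^ (-(d:ℝ)/2) * Real.exp (-‖x - y‖^2 / (2 * τ)) * |f y|)


open Filter Topology

/-- twice differentiable at zero with given values -/
def D2 (f : ℝ → ℝ) (b c : ℝ) : Prop :=
  ∃ f' : ℝ → ℝ, (∀ᶠ h in 𝓝 (0:ℝ), HasDerivAt f (f' h) h) ∧ f' 0 = b ∧ HasDerivAt f' c 0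

theorem D2.hasDerivAt {f : ℝ → ℝ} {b c : ℝ} (h : D2 f b c) : HasDerivAt f b 0 := by
  obtain ⟨f', h1, h2, h3⟩ := h
  rw [← h2]; exact h1.self_of_nhds

theorem D2.add {f g : ℝ → ℝ} {b c b' c' : ℝ} (hf : D2 f b c) (hg : D2 g b' c') :
    D2 (fun h => f h + g h) (b + b') (c + c') := by
  obtain ⟨f', h1, h2, h3⟩ := hf
  obtain ⟨g', k1, k2, k3⟩ := hg
  refine ⟨fun h => f' h + g' h, ?_, by simp [h2, k2], h3.add k3⟩
  filter_upwards [h1, k1] with h a b using a.add b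

theorem D2.const_mul {f : ℝ → ℝ} {b c : ℝ} (a : ℝ) (hf : D2 f b c) :
    D2 (fun h => a * f h) (a * b) (a * c) := by
  obtain ⟨f', h1, h2, h3⟩ := hf
  refine ⟨fun h => a * f' h, ?_, by simp [h2], h3.const_mul a⟩
  filter_upwards [h1] with h k using k.const_mul a

theorem D2.sub {f g : ℝ → ℝ} {b c b' c' : ℝ} (hf : D2 f b c) (hg : D2 g b' c') :
    D2 (fun h => f h - g h) (b - b') (c - c') := by
  obtain ⟨f', h1, h2, h3⟩ := hf
  obtain ⟨g', k1, k2, k3⟩ := hg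
  refine ⟨fun h => f' h - g' h, ?_, by simp [h2, k2], h3.sub k3⟩
  filter_upwards [h1, k1] with h a b using a.sub b

theorem D2.const (a : ℝ) : D2 (fun _ => a) 0 0 :=
  ⟨fun _ => 0, Eventually.of_forall fun h => hasDerivAt_const h a, rfl, hasDerivAt_const 0 0⟩

theorem D2.exp {f : ℝ → ℝ} {b c : ℝ} (hf : D2 f b c) :
    D2 (fun h => Real.exp (f h)) (Real.exp (f 0) * b) (Real.exp (f 0) * (b ^ 2 + c)) := by
  have h0 := hf.hasDerivAt
  obtain ⟨f', h1, h2, h3⟩ := hf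
  refine ⟨fun h => Real.exp (f h) * f' h, ?_, by simp [h2], ?_⟩
  · filter_upwards [h1] with h k using k.exp
  · exact (h0.exp.mul h3).congr_deriv (by rw [h2]; ring)

theorem D2.max {f : ℝ → ℝ} {b c : ℝ} (hf : D2 f b c) (hm : IsLocalMax f 0) : b = 0 ∧ c ≤ 0 := by
  have h0 := hf.hasDerivAt
  have hb : b = 0 := hm.hasDerivAt_eq_zero h0
  refine ⟨hb, ?_⟩
  obtain ⟨f', h1, h2, h3⟩ := hf
  by_contra hc
  push Not at hc
  have e1 : deriv f =ᶠ[𝓝 0] f' := by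
    filter_upwards [h1] with h k using k.deriv
  have e2 : deriv (deriv f) 0 = c := by
    rw [e1.deriv_eq]; exact h3.deriv
  have hmin : IsLocalMin f 0 := isLocalMin_of_deriv_deriv_pos (by rw [e2]; exact hc)
    (by rw [h0.deriv, hb]) h0.continuousAt
  have e3 : f =ᶠ[𝓝 0] fun _ => f 0 := by
    filter_upwards [hm, hmin] with h a b using le_antisymm a b
  have e4 : deriv (deriv f) 0 = 0 := by
    have : deriv f =ᶠ[𝓝 0] deriv (fun _ : ℝ => f 0) := e3.deriv
    rw [this.deriv_eq]; simp
  linarith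

theorem time_touch {g : ℝ → ℝ} {g' t0 : ℝ} (hg : HasDerivAt g g' t0)
    (hm : ∀ᶠ t in 𝓝[<] t0, g t ≤ g t0) : 0 ≤ g' := by
  have h1 := (hasDerivAt_iff_tendsto_slope.1 hg).mono_left
    (nhdsWithin_mono t0 (fun x (hx : x < t0) => ne_of_lt hx) : 𝓝[<] t0 ≤ 𝓝[≠] t0)
  refine ge_of_tendsto h1 ?_
  filter_upwards [hm, self_mem_nhdsWithin] with t ht (ht' : t < t0)
  rw [slope_def_field]
  exact div_nonneg_of_nonpos (by linarith) (by linarith)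

theorem D2_of_contDiff {d : ℕ} {f : EuclideanSpace ℝ (Fin d) → ℝ} (hf : ContDiff ℝ 2 f)
    (x : EuclideanSpace ℝ (Fin d)) (i : Fin d) :
    D2 (fun h => f (x + h • EuclideanSpace.single i (1:ℝ))) ((gradient f x) i)
      (iteratedFDeriv ℝ 2 f x ![EuclideanSpace.single i (1:ℝ), EuclideanSpace.single i (1:ℝ)]) := by
  set v := EuclideanSpace.single i (1:ℝ) with hv
  have hl : ∀ h : ℝ, HasDerivAt (fun h : ℝ => x + h • v) v h := fun h => by
    simpa using ((hasDerivAt_id h).smul_const v).const_add x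
  have hd : Differentiable ℝ f := hf.differentiable (by norm_num)
  have hd2 : Differentiable ℝ (fderiv ℝ f) :=
    (hf.fderiv_right (m := 1) (by norm_num)).differentiable (by norm_num)
  refine ⟨fun h => fderiv ℝ f (x + h • v) v, ?_, ?_, ?_⟩
  · refine Eventually.of_forall fun h => ?_
    exact (hd (x + h • v)).hasFDerivAt.comp_hasDerivAt h (hl h)
  · have h1 : inner ℝ (gradient f x) v = fderiv ℝ f x v := by
      rw [gradient, InnerProductSpace.toDual_symm_apply]
    have h2 : inner ℝ (gradient f x) v = (gradient f x) i := by
      rw [hv, EuclideanSpace.inner_single_right]; simp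
    simp only [zero_smul, add_zero]
    rw [← h1, h2]
  · rw [iteratedFDeriv_two_apply]
    have h1 : HasDerivAt (fun h : ℝ => fderiv ℝ f (x + h • v)) (fderiv ℝ (fderiv ℝ f) (x + (0:ℝ) • v) v) 0 :=
      (hd2 (x + (0:ℝ) • v)).hasFDerivAt.comp_hasDerivAt 0 (hl 0)
    have h2 := h1.clm_apply (hasDerivAt_const (0:ℝ) v)
    simpa using h2

theorem localMax_line {d : ℕ} {f : EuclideanSpace ℝ (Fin d) → ℝ} {x : EuclideanSpace ℝ (Fin d)}
    (hf : IsLocalMax f x) (v : EuclideanSpace ℝ (Fin d)) :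
    IsLocalMax (fun h : ℝ => f (x + h • v)) 0 := by
  have hc : ContinuousAt (fun h : ℝ => x + h • v) 0 := by fun_prop
  have h1 : Tendsto (fun h : ℝ => x + h • v) (𝓝 0) (𝓝 x) := by
    simpa [ContinuousAt] using hc
  have := h1.eventually hf
  simpa [IsLocalMax, IsMaxFilter] using this

theorem param_deriv {d : ℕ} {f : EuclideanSpace ℝ (Fin d) → ℝ} (hf : Continuous f)
    (hc : HasCompactSupport f) (K K' : ℝ → EuclideanSpace ℝ (Fin d) → ℝ) (h0 r : ℝ) (hr : 0 < r)
    (hK : ∀ h ∈ Icc (h0 - r) (h0 + r), Continuous (K h))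
    (hK' : ContinuousOn (fun p : ℝ × EuclideanSpace ℝ (Fin d) => K' p.1 p.2)
      (Icc (h0 - r) (h0 + r) ×ˢ univ))
    (hd : ∀ h ∈ Icc (h0 - r) (h0 + r), ∀ y, HasDerivAt (fun h => K h y) (K' h y) h) :
    HasDerivAt (fun h => ∫ y, K h y * f y) (∫ y, K' h0 y * f y) h0 := by
  have hcomp : IsCompact (Icc (h0 - r) (h0 + r) ×ˢ tsupport f) := isCompact_Icc.prod hc
  obtain ⟨C, hC⟩ := hcomp.exists_bound_of_continuousOn (hK'.mono (prod_mono le_rfl (subset_univ _)))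
  have hmem : Icc (h0 - r) (h0 + r) ∈ 𝓝 h0 := Icc_mem_nhds (by linarith) (by linarith)
  have h0m : h0 ∈ Icc (h0 - r) (h0 + r) := mem_of_mem_nhds hmem
  have hK0 : Continuous (K' h0) := by
    have : ContinuousOn (fun y => K' h0 y) univ :=
      hK'.comp (f := fun y : EuclideanSpace ℝ (Fin d) => (h0, y)) (by fun_prop)
        (fun y _ => ⟨h0m, mem_univ _⟩)
    exact continuousOn_univ.1 this
  refine (hasDerivAt_integral_of_dominated_loc_of_deriv_le (μ := volume) (F := fun h y => K h y * f y)
    (F' := fun h y => K' h y * f y) (bound := fun y => C * |f y|) hmem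
    ?_ ?_ ?_ ?_ ?_ ?_).2
  · filter_upwards [hmem] with h hh
    exact ((hK h hh).mul hf).aestronglyMeasurable
  · exact ((hK h0 h0m).mul hf).integrable_of_hasCompactSupport hc.mul_left
  · exact (hK0.mul hf).aestronglyMeasurable
  · refine Eventually.of_forall fun y h hh => ?_
    by_cases hy : f y = 0
    · simp [hy]
    · have := hC (h, y) ⟨hh, subset_tsupport f hy⟩
      rw [norm_mul, Real.norm_eq_abs (f y)]
      exact mul_le_mul_of_nonneg_right this (abs_nonneg _)
  · exact ((hf.integrable_of_hasCompactSupport hc).abs).const_mul C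
  · exact Eventually.of_forall fun y h hh => (hd h hh y).mul_const (f y)

/-- unnormalised heat flow -/
def heat {d : ℕ} (f : EuclideanSpace ℝ (Fin d) → ℝ) (ν s : ℝ) (x : EuclideanSpace ℝ (Fin d)) : ℝ :=
  ∫ z, Real.exp (-(1 / (4 * ν)) * ‖z‖ ^ 2) * f (x + √s • z)

theorem gauss_integrable {d : ℕ} {b : ℝ} (hb : 0 < b) :
    Integrable (fun z : EuclideanSpace ℝ (Fin d) => Real.exp (-b * ‖z‖ ^ 2)) := by
  by_contra h
  have h1 := GaussianFourier.integral_rexp_neg_mul_sq_norm (V := EuclideanSpace ℝ (Fin d)) hb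
  rw [integral_undef h] at h1
  have : 0 < (π / b) ^ ((Module.finrank ℝ (EuclideanSpace ℝ (Fin d)) : ℝ) / 2) := by positivity
  linarith

theorem gauss_pos {d : ℕ} {b : ℝ} (hb : 0 < b) :
    0 < ∫ z : EuclideanSpace ℝ (Fin d), Real.exp (-b * ‖z‖ ^ 2) := by
  rw [GaussianFourier.integral_rexp_neg_mul_sq_norm hb]
  positivity

theorem heat_continuous {d : ℕ} {f : EuclideanSpace ℝ (Fin d) → ℝ} (hf : Continuous f)
    (hc : HasCompactSupport f) {ν : ℝ} (hν : 0 < ν) :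
    Continuous (fun p : ℝ × EuclideanSpace ℝ (Fin d) => heat f ν p.1 p.2) := by
  obtain ⟨C, hC⟩ := hf.bounded_above_of_compact_support hc
  unfold heat
  refine continuous_of_dominated (bound := fun z => Real.exp (-(1 / (4 * ν)) * ‖z‖ ^ 2) * C)
    ?_ ?_ ?_ ?_
  · intro p
    exact Continuous.aestronglyMeasurable (by fun_prop)
  · intro p
    refine Eventually.of_forall fun z => ?_
    rw [norm_mul, Real.norm_eq_abs, abs_of_pos (Real.exp_pos _)]
    exact mul_le_mul_of_nonneg_left (hC _) (Real.exp_pos _).le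
  · exact (gauss_integrable (by positivity)).mul_const C
  · refine Eventually.of_forall fun z => by fun_prop

theorem heat_zero {d : ℕ} (f : EuclideanSpace ℝ (Fin d) → ℝ) (ν : ℝ)
    (x : EuclideanSpace ℝ (Fin d)) :
    heat f ν 0 x = (∫ z : EuclideanSpace ℝ (Fin d), Real.exp (-(1 / (4 * ν)) * ‖z‖ ^ 2)) * f x := by
  unfold heat
  simp [integral_mul_const]

/-- heat kernel -/
def hk (d : ℕ) (ν s q : ℝ) : ℝ := Real.exp (-(d / 2 : ℝ) * Real.log s - q / (4 * ν * s))

theorem heat_eq {d : ℕ} (f : EuclideanSpace ℝ (Fin d) → ℝ) {ν s : ℝ} (hν : 0 < ν) (hs : 0 < s)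
    (x : EuclideanSpace ℝ (Fin d)) :
    heat f ν s x = ∫ y, hk d ν s (‖x - y‖ ^ 2) * f y := by
  have h1 := Measure.integral_comp_smul (volume : Measure (EuclideanSpace ℝ (Fin d)))
    (fun w => Real.exp (-(1 / (4 * ν * s)) * ‖w‖ ^ 2) * f (x + w)) (√s)
  have hsq : √s ^ 2 = s := Real.sq_sqrt hs.le
  have h2 : heat f ν s x = ∫ z : EuclideanSpace ℝ (Fin d),
      Real.exp (-(1 / (4 * ν * s)) * ‖√s • z‖ ^ 2) * f (x + √s • z) := by
    unfold heat
    congr 1; ext z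
    congr 2
    rw [norm_smul, mul_pow, Real.norm_eq_abs, sq_abs, hsq]
    field_simp
  rw [h2, h1]
  have h3 := integral_add_left_eq_self (μ := (volume : Measure (EuclideanSpace ℝ (Fin d))))
    (fun y => Real.exp (-(1 / (4 * ν * s)) * ‖y - x‖ ^ 2) * f y) x
  simp only [add_sub_cancel_left] at h3
  rw [h3, ← integral_smul]
  congr 1; ext y
  have h4 : |(√s ^ Module.finrank ℝ (EuclideanSpace ℝ (Fin d)))⁻¹| =
      Real.exp (-(d / 2 : ℝ) * Real.log s) := by
    rw [abs_of_nonneg (by positivity), finrank_euclideanSpace_fin]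
    rw [← Real.exp_log (show 0 < (√s ^ d)⁻¹ by positivity), Real.log_inv, Real.log_pow,
      Real.log_sqrt hs.le]
    congr 1; ring
  rw [h4, smul_eq_mul, ← mul_assoc, ← Real.exp_add, hk, norm_sub_rev x y]
  congr 2
  ring

theorem heat_time {d : ℕ} {f : EuclideanSpace ℝ (Fin d) → ℝ} (hf : Continuous f)
    (hc : HasCompactSupport f) {ν s : ℝ} (hν : 0 < ν) (hs : 0 < s) (x : EuclideanSpace ℝ (Fin d)) :
    HasDerivAt (fun s => heat f ν s x)
      (∫ y, (hk d ν s (‖x - y‖ ^ 2) * (-(d / 2 : ℝ) / s + ‖x - y‖ ^ 2 / (4 * ν * s ^ 2))) * f y) s := by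
  have key := param_deriv hf hc (fun s y => hk d ν s (‖x - y‖ ^ 2))
    (fun s y => hk d ν s (‖x - y‖ ^ 2) * (-(d / 2 : ℝ) / s + ‖x - y‖ ^ 2 / (4 * ν * s ^ 2)))
    s (s / 2) (by linarith) ?_ ?_ ?_
  · refine key.congr_of_eventuallyEq ?_
    filter_upwards [lt_mem_nhds hs] with s' hs'
    exact heat_eq f hν hs' x
  · intro h hh
    unfold hk; fun_prop
  · unfold hk
    have hpos : ∀ p ∈ Icc (s - s / 2) (s + s / 2) ×ˢ (univ : Set (EuclideanSpace ℝ (Fin d))),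
        p.1 ≠ 0 := by
      rintro p ⟨⟨h1, h2⟩, -⟩
      have : 0 < p.1 := by linarith
      exact this.ne'
    have hpos2 : ∀ p ∈ Icc (s - s / 2) (s + s / 2) ×ˢ (univ : Set (EuclideanSpace ℝ (Fin d))),
        4 * ν * p.1 ≠ 0 := fun p hp => mul_ne_zero (by positivity) (hpos p hp)
    have hpos3 : ∀ p ∈ Icc (s - s / 2) (s + s / 2) ×ˢ (univ : Set (EuclideanSpace ℝ (Fin d))),
        4 * ν * p.1 ^ 2 ≠ 0 := fun p hp => mul_ne_zero (by positivity) (pow_ne_zero _ (hpos p hp))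
    fun_prop (disch := assumption)
  · intro h hh y
    have hp : 0 < h := by have := hh.1; linarith
    unfold hk
    have h1 : HasDerivAt (fun s => -(d / 2 : ℝ) * Real.log s - ‖x - y‖ ^ 2 / (4 * ν * s))
        (-(d / 2 : ℝ) / h + ‖x - y‖ ^ 2 / (4 * ν * h ^ 2)) h := by
      have a1 := (Real.hasDerivAt_log hp.ne').const_mul (-(d / 2 : ℝ))
      have a2 := ((hasDerivAt_inv hp.ne').const_mul (‖x - y‖ ^ 2 / (4 * ν)))
      have a3 := a1.sub a2
      refine (a3.congr_deriv ?_).congr_of_eventuallyEq ?_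
      · field_simp; ring
      · filter_upwards [lt_mem_nhds hp] with s' hs'
        simp only [Pi.sub_apply]
        field_simp
    exact h1.exp

theorem norm_line {d : ℕ} (x : EuclideanSpace ℝ (Fin d)) (h : ℝ) (i : Fin d) :
    ‖x + h • EuclideanSpace.single i (1:ℝ)‖ ^ 2 = ‖x‖ ^ 2 + 2 * h * x i + h ^ 2 := by
  rw [norm_add_sq_real, inner_smul_right, EuclideanSpace.inner_single_right, norm_smul]
  simp
  ring

theorem heat_space {d : ℕ} {f : EuclideanSpace ℝ (Fin d) → ℝ} (hf : Continuous f)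
    (hc : HasCompactSupport f) {ν s : ℝ} (hν : 0 < ν) (hs : 0 < s) (x : EuclideanSpace ℝ (Fin d))
    (i : Fin d) : ∃ b,
    D2 (fun h => heat f ν s (x + h • EuclideanSpace.single i (1:ℝ))) b
      (∫ y, (hk d ν s (‖x - y‖ ^ 2) * (((x - y) i) ^ 2 / (4 * ν ^ 2 * s ^ 2) - 1 / (2 * ν * s))) * f y) := by
  have hpos2 : 4 * ν * s ≠ 0 := by positivity
  have hpos3 : 2 * ν * s ≠ 0 := by positivity
  let Q : ℝ → EuclideanSpace ℝ (Fin d) → ℝ := fun h y => ‖x - y‖ ^ 2 + 2 * h * (x - y) i + h ^ 2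
  have hk0 : ∀ h y, HasDerivAt (fun h => hk d ν s (Q h y))
      (hk d ν s (Q h y) * (-((x - y) i + h) / (2 * ν * s))) h := by
    intro h y
    unfold hk
    refine HasDerivAt.exp ?_
    have a1 : HasDerivAt (fun h => Q h y) (2 * (x - y) i + 2 * h) h := by
      have b1 : HasDerivAt (fun h : ℝ => ‖x - y‖ ^ 2 + 2 * h * (x - y) i + h ^ 2)
        (2 * 1 * (x - y) i + (2:ℕ) * h ^ (2-1) * 1) h :=
        ((((hasDerivAt_id h).const_mul 2).mul_const ((x - y) i)).const_add (‖x - y‖ ^ 2)).add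
          ((hasDerivAt_id h).pow 2)
      refine b1.congr_deriv ?_
      simp
    refine ((a1.div_const (4 * ν * s)).const_sub _).congr_deriv ?_
    field_simp; ring
  have hcy : ∀ j, Continuous (fun y : EuclideanSpace ℝ (Fin d) => (x - y) j) := fun j => by fun_prop
  refine ⟨∫ y, (hk d ν s (Q 0 y) * (-((x - y) i + 0) / (2 * ν * s))) * f y,
    fun h => ∫ y, (hk d ν s (Q h y) * (-((x - y) i + h) / (2 * ν * s))) * f y, ?_, rfl, ?_⟩
  · refine Eventually.of_forall fun h => ?_
    have := param_deriv hf hc (fun h y => hk d ν s (Q h y))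
      (fun h y => hk d ν s (Q h y) * (-((x - y) i + h) / (2 * ν * s))) h 1 one_pos ?_ ?_ ?_
    · refine this.congr_of_eventuallyEq (Eventually.of_forall fun h' => ?_)
      simp only
      rw [heat_eq f hν hs]
      congr 1; ext y
      rw [show x + h' • EuclideanSpace.single i (1:ℝ) - y =
        (x - y) + h' • EuclideanSpace.single i (1:ℝ) by abel, norm_line]
    · intro h' _
      unfold hk Q; fun_prop
    · unfold hk Q
      exact Continuous.continuousOn (by fun_prop)
    · intro h' _ y
      exact hk0 h' y
  · have := param_deriv hf hc (fun h y => hk d ν s (Q h y) * (-((x - y) i + h) / (2 * ν * s)))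
      (fun h y => hk d ν s (Q h y) * ((-((x - y) i + h) / (2 * ν * s)) ^ 2 - 1 / (2 * ν * s))) 0 1 one_pos
      ?_ ?_ ?_
    · refine this.congr_deriv ?_
      congr 1; ext y
      simp only [Q]
      congr 2
      · congr 1; ring
      · field_simp; ring
    · intro h' _
      unfold hk Q; fun_prop
    · unfold hk Q
      exact Continuous.continuousOn (by fun_prop)
    · intro h' _ y
      have b1 : HasDerivAt (fun h : ℝ => -((x - y) i + h) / (2 * ν * s)) (-1 / (2 * ν * s)) h' :=
        (((hasDerivAt_id h').const_add ((x - y) i)).neg).div_const _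
      refine ((hk0 h' y).mul b1).congr_deriv ?_
      ring

theorem heat_pde {d : ℕ} {f : EuclideanSpace ℝ (Fin d) → ℝ} (hf : Continuous f)
    (hc : HasCompactSupport f) {ν s : ℝ} (hν : 0 < ν) (hs : 0 < s) (x : EuclideanSpace ℝ (Fin d)) :
    ∃ (b l : Fin d → ℝ),
      (∀ i, D2 (fun h => heat f ν s (x + h • EuclideanSpace.single i (1:ℝ))) (b i) (l i)) ∧
      HasDerivAt (fun s => heat f ν s x) (ν * ∑ i, l i) s := by
  choose b hb using fun i => heat_space hf hc hν hs x i
  refine ⟨b, _, hb, (heat_time hf hc hν hs x).congr_deriv ?_⟩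
  rw [← integral_finsetSum, ← integral_const_mul]
  · congr 1; ext y
    rw [← Finset.sum_mul, ← Finset.mul_sum, Finset.sum_sub_distrib, ← Finset.sum_div,
      ← EuclideanSpace.real_norm_sq_eq]
    simp only [Finset.sum_const, Finset.card_univ, Fintype.card_fin, nsmul_eq_mul]
    field_simp
    ring
  · intro i _
    refine Continuous.integrable_of_hasCompactSupport ?_ hc.mul_left
    unfold hk; fun_prop

theorem heat_nonneg {d : ℕ} {f : EuclideanSpace ℝ (Fin d) → ℝ} (hf : ∀ x, 0 ≤ f x) (ν s : ℝ)
    (x : EuclideanSpace ℝ (Fin d)) : 0 ≤ heat f ν s x :=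
  integral_nonneg fun z => mul_nonneg (Real.exp_pos _).le (hf _)

theorem local_bound {d : ℕ} {ν lam κ : ℝ} (hν : 0 < ν) (hκ0 : 0 < κ)
    (hκ : lam ≤ ν * κ) {m : ℝ → EuclideanSpace ℝ (Fin d) → ℝ} {t0 t1 : ℝ} (ht : t0 < t1)
    (x1 : EuclideanSpace ℝ (Fin d)) {ϱ : ℝ} (hϱ : 0 < ϱ)
    (hcont : ContinuousOn (fun p : ℝ × EuclideanSpace ℝ (Fin d) => m p.1 p.2) (Icc t0 t1 ×ˢ univ))
    (hsp : ∀ t ∈ Ioc t0 t1, ContDiff ℝ 2 (m t))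
    (htime : ∀ x, ∀ t ∈ Ioc t0 t1, DifferentiableAt ℝ (fun s => m s x) t)
    (hsub : ∀ t ∈ Ioc t0 t1, ∀ x, deriv (fun s => m s x) t ≤
      ν * lapl (m t) x + lam * ‖gradient (m t) x‖ ^ 2)
    {B : ℝ} (hB : ∀ t ∈ Icc t0 t1, ∀ x, ‖x - x1‖ ≤ ϱ → Real.exp (κ * m t x) ≤ B)
    {f : EuclideanSpace ℝ (Fin d) → ℝ} (hf : Continuous f) (hc : HasCompactSupport f)
    (hf0 : ∀ x, 0 ≤ f x) (hfm : ∀ x, ‖x - x1‖ ≤ ϱ → Real.exp (κ * m t0 x) ≤ f x) :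
    Real.exp (κ * m t1 x1) ≤ heat f ν (t1 - t0) x1 /
      (∫ z : EuclideanSpace ℝ (Fin d), Real.exp (-(1 / (4 * ν)) * ‖z‖ ^ 2)) +
      B * (2 * d * ν * (t1 - t0) / ϱ ^ 2) := by
  set Z := ∫ z : EuclideanSpace ℝ (Fin d), Real.exp (-(1 / (4 * ν)) * ‖z‖ ^ 2) with hZ
  have hZ0 : 0 < Z := gauss_pos (by positivity)
  have hB0 : 0 < B := lt_of_lt_of_le (Real.exp_pos _)
    (hB t0 ⟨le_rfl, ht.le⟩ x1 (by simpa using hϱ.le))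
  by_contra hcon
  push Not at hcon
  set gap := Real.exp (κ * m t1 x1) - (heat f ν (t1 - t0) x1 / Z +
      B * (2 * d * ν * (t1 - t0) / ϱ ^ 2)) with hgap
  have hgap0 : 0 < gap := by rw [hgap]; linarith
  obtain ⟨ε, hε0, hε⟩ : ∃ ε : ℝ, 0 < ε ∧ ε * (1 + (t1 - t0)) < gap := by
    have hp : 0 < 1 + (t1 - t0) := by linarith
    refine ⟨gap / (1 + (t1 - t0)) / 2, by positivity, ?_⟩
    field_simp; linarith
  let Y : ℝ → EuclideanSpace ℝ (Fin d) → ℝ := fun t x =>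
    heat f ν (t - t0) x / Z + B * ((‖x - x1‖ ^ 2 + 2 * d * ν * (t - t0)) / ϱ ^ 2) +
      ε * (1 + (t - t0))
  let F : ℝ → EuclideanSpace ℝ (Fin d) → ℝ := fun t x => Real.exp (κ * m t x) - Y t x
  have hFc : ContinuousOn (fun p : ℝ × EuclideanSpace ℝ (Fin d) => F p.1 p.2)
      (Icc t0 t1 ×ˢ Metric.closedBall x1 ϱ) := by
    have hm1 := hcont.mono (prod_mono (le_refl (Icc t0 t1)) (subset_univ (Metric.closedBall x1 ϱ)))
    have hh : Continuous (fun p : ℝ × EuclideanSpace ℝ (Fin d) => heat f ν (p.1 - t0) p.2) :=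
      (heat_continuous hf hc hν).comp (f := fun p : ℝ × EuclideanSpace ℝ (Fin d) => (p.1 - t0, p.2))
        (by fun_prop)
    have hY : Continuous (fun p : ℝ × EuclideanSpace ℝ (Fin d) => Y p.1 p.2) := by
      simp only [Y]; fun_prop
    exact (hm1.const_smul κ).rexp.sub hY.continuousOn
  have hz : (t1, x1) ∈ Icc t0 t1 ×ˢ Metric.closedBall x1 ϱ :=
    ⟨⟨ht.le, le_rfl⟩, Metric.mem_closedBall_self hϱ.le⟩
  obtain ⟨⟨t, x⟩, ⟨htm, hxm⟩, hmax⟩ := (isCompact_Icc.prod (isCompact_closedBall x1 ϱ)).exists_isMaxOn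
    ⟨_, hz⟩ hFc
  simp only at htm hxm
  have hFz : 0 < F t1 x1 := by
    simp only [F, Y, sub_self, norm_zero]
    have : (0:ℝ) ^ 2 + 2 * d * ν * (t1 - t0) = 2 * d * ν * (t1 - t0) := by ring
    rw [this]; linarith
  have hFp : 0 < F t x := lt_of_lt_of_le hFz (hmax hz)
  have hxm' : ‖x - x1‖ ≤ ϱ := by rwa [mem_closedBall_iff_norm] at hxm
  have ht0 : t0 < t := by
    refine lt_of_le_of_ne htm.1 ?_
    rintro rfl
    have h1 := hfm x hxm'
    have h2 : heat f ν (t0 - t0) x / Z = f x := by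
      rw [sub_self, heat_zero, ← hZ]; field_simp
    have h3 : 0 ≤ B * ((‖x - x1‖ ^ 2 + 2 * d * ν * (t0 - t0)) / ϱ ^ 2) := by
      rw [sub_self]; positivity
    simp only [F, Y, h2] at hFp
    rw [sub_self] at hFp h3
    linarith
  have hx0 : ‖x - x1‖ < ϱ := by
    refine lt_of_le_of_ne hxm' ?_
    intro he
    have h1 := hB t htm x hxm'
    have h2 : 0 ≤ heat f ν (t - t0) x / Z := div_nonneg (heat_nonneg hf0 _ _ _) hZ0.le
    have h3 : B ≤ B * ((‖x - x1‖ ^ 2 + 2 * d * ν * (t - t0)) / ϱ ^ 2) := by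
      refine le_mul_of_one_le_right hB0.le ?_
      rw [he, le_div_iff₀ (by positivity)]
      have : 0 ≤ 2 * d * ν * (t - t0) := mul_nonneg (by positivity) (by linarith)
      linarith
    have h4 : 0 < ε * (1 + (t - t0)) := mul_pos hε0 (by linarith)
    simp only [F, Y] at hFp
    linarith
  have htI : t ∈ Ioc t0 t1 := ⟨ht0, htm.2⟩
  -- derivatives
  obtain ⟨hb, hl, hD, hT⟩ := heat_pde hf hc hν (sub_pos.2 ht0) x
  have hmt : HasDerivAt (fun s => m s x) (deriv (fun s => m s x) t) t := (htime x t htI).hasDerivAt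
  have hTs : HasDerivAt (fun s => heat f ν (s - t0) x) (ν * ∑ i, hl i) t := by
    have := HasDerivAt.comp (h := fun s => s - t0) t hT ((hasDerivAt_id t).sub_const t0)
    exact this.congr_deriv (by simp)
  have hFt : HasDerivAt (fun s => F s x) (Real.exp (κ * m t x) * (κ * deriv (fun s => m s x) t) -
      ((ν * ∑ i, hl i) / Z + B * ((2 * d * ν) / ϱ ^ 2) + ε)) t := by
    have a1 := (hmt.const_mul κ).exp
    have a2 : HasDerivAt (fun s : ℝ => s - t0) 1 t := (hasDerivAt_id t).sub_const t0
    have a3 := (((a2.const_mul (2 * d * ν)).const_add (‖x - x1‖ ^ 2)).div_const (ϱ ^ 2)).const_mul B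
    have a4 := (a2.const_add 1).const_mul ε
    have a5 := a1.sub (((hTs.div_const Z).add a3).add a4)
    refine a5.congr_deriv ?_
    ring
  have htouch := time_touch hFt (by
    have : Ioo t0 t ∈ 𝓝[<] t := Ioo_mem_nhdsLT ht0
    filter_upwards [this] with s hs
    exact hmax (show (s, x) ∈ _ from ⟨⟨hs.1.le, hs.2.le.trans htm.2⟩, hxm⟩))
  have hloc : IsLocalMax (F t) x := by
    have : Metric.ball x1 ϱ ∈ 𝓝 x := Metric.isOpen_ball.mem_nhds (by
      rw [mem_ball_iff_norm]; exact hx0)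
    filter_upwards [this] with y hy
    exact hmax (show (t, y) ∈ _ from ⟨htm, Metric.ball_subset_closedBall hy⟩)
  have hsq : ∀ i, D2 (fun h : ℝ => ‖x + h • EuclideanSpace.single i (1:ℝ) - x1‖ ^ 2)
      (2 * (x - x1) i) 2 := by
    intro i
    refine ⟨fun h => 2 * (x - x1) i + 2 * h, Eventually.of_forall fun h => ?_, by simp, ?_⟩
    · have b1 : HasDerivAt (fun h : ℝ => ‖x - x1‖ ^ 2 + 2 * h * (x - x1) i + h ^ 2)
        (2 * 1 * (x - x1) i + (2:ℕ) * h ^ (2-1) * 1) h :=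
        ((((hasDerivAt_id h).const_mul 2).mul_const ((x - x1) i)).const_add (‖x - x1‖ ^ 2)).add
          ((hasDerivAt_id h).pow 2)
      refine (b1.congr_deriv (by simp)).congr_of_eventuallyEq (Eventually.of_forall fun h' => ?_)
      simp only
      rw [show x + h' • EuclideanSpace.single i (1:ℝ) - x1 =
        (x - x1) + h' • EuclideanSpace.single i (1:ℝ) by abel, norm_line]
    · simpa using ((hasDerivAt_id (0:ℝ)).const_mul 2).const_add (2 * (x - x1) i)
  set φ := Real.exp (κ * m t x) with hφ
  set lm : Fin d → ℝ := fun i => iteratedFDeriv ℝ 2 (m t) x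
    ![EuclideanSpace.single i (1:ℝ), EuclideanSpace.single i (1:ℝ)] with hlm
  have hcoord : ∀ i, φ * (κ ^ 2 * (gradient (m t) x i) ^ 2 + κ * lm i) -
      (hl i / Z + B * (2 / ϱ ^ 2)) ≤ 0 := by
    intro i
    have c1 := ((D2_of_contDiff (hsp t htI) x i).const_mul κ).exp
    have c2 := (((hD i).const_mul (1 / Z)).add ((hsq i).const_mul (B / ϱ ^ 2))).add
      (D2.const (B * (2 * d * ν * (t - t0) / ϱ ^ 2) + ε * (1 + (t - t0))))
    have c3 := c1.sub c2
    have c4 := localMax_line hloc (EuclideanSpace.single i (1:ℝ))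
    have c5 : (fun h : ℝ => F t (x + h • EuclideanSpace.single i (1:ℝ))) = fun h =>
        Real.exp (κ * m t (x + h • EuclideanSpace.single i (1:ℝ))) -
        (1 / Z * heat f ν (t - t0) (x + h • EuclideanSpace.single i (1:ℝ)) +
          B / ϱ ^ 2 * ‖x + h • EuclideanSpace.single i (1:ℝ) - x1‖ ^ 2 +
          (B * (2 * d * ν * (t - t0) / ϱ ^ 2) + ε * (1 + (t - t0)))) := by
      funext h; simp only [F, Y]; ring
    rw [c5] at c4
    have c6 := (c3.max c4).2
    simp only [zero_smul, add_zero] at c6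
    calc _ = _ := by rw [hφ]; ring
      _ ≤ 0 := c6
  have hsum := Finset.sum_nonpos (s := Finset.univ) (fun i _ => hcoord i)
  rw [Finset.sum_sub_distrib, ← Finset.mul_sum, Finset.sum_add_distrib, ← Finset.mul_sum,
    ← Finset.mul_sum, Finset.sum_add_distrib, ← Finset.sum_div,
    ← EuclideanSpace.real_norm_sq_eq] at hsum
  simp only [Finset.sum_const, Finset.card_univ, Fintype.card_fin, nsmul_eq_mul] at hsum
  have hs1 := hsub t htI x
  have hlap : lapl (m t) x = ∑ i, lm i := rfl
  rw [hlap] at hs1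
  have hφ0 : 0 < φ := Real.exp_pos _
  set G := ‖gradient (m t) x‖ ^ 2 with hG
  have hG0 : 0 ≤ G := by positivity
  have e1 : φ * (κ * deriv (fun s => m s x) t) ≤ φ * (κ * (ν * ∑ i, lm i + ν * κ * G)) := by
    have : lam * G ≤ ν * κ * G := mul_le_mul_of_nonneg_right hκ hG0
    gcongr; linarith
  have e2 := mul_le_mul_of_nonneg_left hsum hν.le
  have e3 : ν * (φ * (κ ^ 2 * G + κ * ∑ i, lm i) - ((∑ i, hl i) / Z + d * (B * (2 / ϱ ^ 2)))) =
    φ * (κ * (ν * ∑ i, lm i + ν * κ * G)) - ((ν * ∑ i, hl i) / Z + B * ((2 * d * ν) / ϱ ^ 2)) := by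
    ring
  rw [e3] at e2
  linarith

theorem slice_bound {d : ℕ} {lam T : ℝ} (hlam : 0 < lam)
    {m : ℝ → EuclideanSpace ℝ (Fin d) → ℝ} (hmc : ∀ t ∈ Icc (0:ℝ) T, Continuous (m t))
    (hstar : (⨆ t ∈ Set.Icc (0:ℝ) T, fstar (fun y => Real.exp (2 * lam * |m t y|)) 0) < ⊤) :
    ∃ M : ℝ, 0 ≤ M ∧ ∀ t ∈ Icc (0:ℝ) T, ∀ R : ℝ, 0 < R →
      ∫ y in Metric.closedBall (0 : EuclideanSpace ℝ (Fin d)) R, Real.exp (2 * lam * m t y)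
        ≤ M * R ^ d := by
  set S := ⨆ t ∈ Set.Icc (0:ℝ) T, fstar (fun y => Real.exp (2 * lam * |m t y|))
    (0 : EuclideanSpace ℝ (Fin d)) with hS
  set a := (2 * π) ^ (-(d:ℝ)/2) * Real.exp (-1/2) with ha
  have ha0 : 0 < a := by positivity
  refine ⟨S.toReal / a, by positivity, fun t ht R hR => ?_⟩
  have h1 : ∫⁻ y : EuclideanSpace ℝ (Fin d), ENNReal.ofReal ((2 * π * R ^ 2) ^ (-(d:ℝ)/2) *
      Real.exp (-‖0 - y‖^2 / (2 * R ^ 2)) * |Real.exp (2 * lam * |m t y|)|) ≤ S := by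
    have e1 : fstar (fun y => Real.exp (2 * lam * |m t y|)) 0 ≤ S :=
      le_iSup₂ (f := fun t (_ : t ∈ Set.Icc (0:ℝ) T) =>
        fstar (fun y => Real.exp (2 * lam * |m t y|)) (0 : EuclideanSpace ℝ (Fin d))) t ht
    refine le_trans ?_ e1
    exact le_iSup₂ (f := fun τ (_ : τ ∈ Set.Ioi (0:ℝ)) =>
      ∫⁻ y : EuclideanSpace ℝ (Fin d), ENNReal.ofReal ((2 * π * τ) ^ (-(d:ℝ)/2) *
      Real.exp (-‖0 - y‖^2 / (2 * τ)) * |Real.exp (2 * lam * |m t y|)|)) (R ^ 2)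
      (show R ^ 2 ∈ Set.Ioi (0:ℝ) from by simp only [Set.mem_Ioi]; positivity)
  have hint : IntegrableOn (fun y => Real.exp (2 * lam * m t y))
      (Metric.closedBall (0 : EuclideanSpace ℝ (Fin d)) R) := by
    have := hmc t ht
    exact (by fun_prop : Continuous fun y => Real.exp (2 * lam * m t y)).continuousOn.integrableOn_compact
      (isCompact_closedBall _ _)
  have hconst : (2 * π * R ^ 2) ^ (-(d:ℝ)/2) * Real.exp (-1/2) = a / R ^ d := by
    rw [Real.mul_rpow (by positivity) (by positivity), ha]
    have : (R ^ 2) ^ (-(d:ℝ)/2) = (R ^ d)⁻¹ := by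
      rw [← Real.rpow_natCast R 2, ← Real.rpow_mul hR.le, ← Real.rpow_natCast R d,
        ← Real.rpow_neg hR.le]
      congr 1; push_cast; ring
    rw [this]; ring
  have h2 : ENNReal.ofReal (∫ y in Metric.closedBall (0 : EuclideanSpace ℝ (Fin d)) R,
      a / R ^ d * Real.exp (2 * lam * m t y)) ≤ S := by
    rw [ofReal_integral_eq_lintegral_ofReal (hint.const_mul _)
      (ae_of_all _ fun y => by positivity)]
    refine le_trans ?_ h1
    refine le_trans ?_ (setLIntegral_le_lintegral (Metric.closedBall 0 R) _)
    refine setLIntegral_mono' Metric.isClosed_closedBall.measurableSet fun y hy => ?_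
    apply ENNReal.ofReal_le_ofReal
    rw [← hconst, abs_of_pos (Real.exp_pos _)]
    rw [mem_closedBall_zero_iff] at hy
    have e1 : -1/2 ≤ -‖0 - y‖^2 / (2 * R ^ 2) := by
      rw [zero_sub, norm_neg, div_le_div_iff₀ (by norm_num) (by positivity)]
      have : ‖y‖ ^ 2 ≤ R ^ 2 := by gcongr
      linarith
    gcongr
    exact le_abs_self _
  rw [integral_const_mul] at h2
  have h3 : a / R ^ d * ∫ y in Metric.closedBall (0 : EuclideanSpace ℝ (Fin d)) R,
      Real.exp (2 * lam * m t y) ≤ S.toReal :=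
    (ENNReal.ofReal_le_iff_le_toReal hstar.ne).1 h2
  rw [div_mul_eq_mul_div, div_le_iff₀ (by positivity)] at h3
  rw [div_mul_eq_mul_div, le_div_iff₀ ha0]
  linarith

theorem heat_bound {d : ℕ} {f e : EuclideanSpace ℝ (Fin d) → ℝ}
    (hf0 : ∀ y, 0 ≤ f y) (he : Continuous e) {ν s c r : ℝ} (hν : 0 < ν) (hs : 0 < s)
    (x : EuclideanSpace ℝ (Fin d))
    (h1 : ∀ y, r < ‖y - x‖ → f y = 0) (h2 : ∀ y, ‖y - x‖ ≤ r → f y ≤ c * e y) :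
    heat f ν s x ≤ Real.exp (-(d/2 : ℝ) * Real.log s) *
      (c * ∫ y in Metric.closedBall x r, e y) := by
  rw [heat_eq f hν hs x]
  have i1 : Integrable (fun y => (Metric.closedBall x r).indicator (fun y => c * e y) y) :=
    ((he.const_mul c).continuousOn.integrableOn_compact
      (isCompact_closedBall _ _)).integrable_indicator Metric.isClosed_closedBall.measurableSet
  have h3 : ∀ y, f y ≤ (Metric.closedBall x r).indicator (fun y => c * e y) y := by
    intro y
    by_cases hy : ‖y - x‖ ≤ r
    · rw [indicator_of_mem (by rwa [mem_closedBall_iff_norm])]; exact h2 y hy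
    · rw [indicator_of_notMem (by rwa [mem_closedBall_iff_norm])]
      exact (h1 y (not_le.1 hy)).le
  calc _ ≤ ∫ y, Real.exp (-(d/2 : ℝ) * Real.log s) *
        (Metric.closedBall x r).indicator (fun y => c * e y) y := by
        refine integral_mono_of_nonneg (ae_of_all _ fun y => mul_nonneg (Real.exp_pos _).le (hf0 y))
          (i1.const_mul _) (ae_of_all _ fun y => ?_)
        refine mul_le_mul ?_ (h3 y) (hf0 y) (Real.exp_pos _).le
        apply Real.exp_le_exp.2
        have : 0 ≤ ‖x - y‖ ^ 2 / (4 * ν * s) := by positivity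
        linarith
    _ = _ := by
      rw [integral_const_mul, integral_indicator Metric.isClosed_closedBall.measurableSet,
        integral_const_mul]

theorem pick_bound {d : ℕ} (hd : 1 ≤ d) {ν lam T : ℝ} (hν : 0 < ν) (hlam : 0 < lam) (hT : 0 < T)
    {m : ℝ → EuclideanSpace ℝ (Fin d) → ℝ}
    (hcont : ContinuousOn (fun p : ℝ × EuclideanSpace ℝ (Fin d) => m p.1 p.2) (Icc 0 T ×ˢ univ))
    (hsp : ∀ t ∈ Ioc 0 T, ContDiff ℝ 2 (m t))
    (htime : ∀ x, ∀ t ∈ Ioc 0 T, DifferentiableAt ℝ (fun s => m s x) t)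
    (hsub : ∀ t ∈ Ioc 0 T, ∀ x, deriv (fun s => m s x) t ≤
      ν * lapl (m t) x + lam * ‖gradient (m t) x‖ ^ 2)
    (hstar : (⨆ t ∈ Set.Icc (0:ℝ) T, fstar (fun y => Real.exp (2 * lam * |m t y|)) 0) < ⊤) :
    ∃ C : ℝ, ∀ t ∈ Ioc 0 T, ∀ x,
      Real.exp (2 * lam * m t x) * √(t / T) ^ d ≤ C * (2 + ‖x‖) ^ d := by
  have hmc : ∀ t ∈ Icc (0:ℝ) T, Continuous (m t) := by
    intro t ht
    rw [← continuousOn_univ]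
    exact hcont.comp (f := fun x => (t, x)) (by fun_prop) (fun x _ => ⟨ht, mem_univ _⟩)
  obtain ⟨M, hM0, hM⟩ := slice_bound hlam hmc hstar
  have hd0 : (0:ℝ) < d := by exact_mod_cast hd
  set κ := max (2 * lam) (lam / ν) with hκdef
  have hκ1 : 2 * lam ≤ κ := le_max_left _ _
  have hκ2 : lam ≤ ν * κ := by
    have := le_max_right (2 * lam) (lam / ν)
    rw [div_le_iff₀ hν] at this; linarith
  have hκ0 : 0 < κ := by linarith
  set b := d * Real.log 2 / (2 * lam) with hb
  have hb0 : 0 ≤ b := by have := Real.log_nonneg (show (1:ℝ) ≤ 2 by norm_num); positivity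
  set H := Real.exp (κ * b) with hH
  have hH0 : 0 < H := Real.exp_pos _
  set Z := ∫ z : EuclideanSpace ℝ (Fin d), Real.exp (-(1 / (4 * ν)) * ‖z‖ ^ 2) with hZ
  have hZ0 : 0 < Z := gauss_pos (by positivity)
  set c0 := min (3 * T / 4) (1 / (64 * d * ν * H)) with hc0
  have hc00 : 0 < c0 := lt_min (by positivity) (by positivity)
  have hc01 : c0 ≤ 3 * T / 4 := min_le_left _ _
  have hc02 : 64 * d * ν * H * c0 ≤ 1 := by
    have := min_le_right (3 * T / 4) (1 / (64 * d * ν * H))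
    rw [← hc0, le_div_iff₀ (by positivity)] at this; linarith
  refine ⟨2 / Z * Real.exp (-(d/2 : ℝ) * Real.log c0) * H * M, fun ts hts xs => ?_⟩
  let D : ℝ × EuclideanSpace ℝ (Fin d) → ℝ := fun p => min (√(p.1 / T)) (1 - ‖p.2 - xs‖)
  have hDc : Continuous D := by simp only [D]; fun_prop
  have hPc : ContinuousOn (fun p => Real.exp (2 * lam * m p.1 p.2) * D p ^ d)
      (Icc 0 ts ×ˢ Metric.closedBall xs 1) := by
    have h1 := hcont.mono (prod_mono (Icc_subset_Icc_right hts.2 : Icc 0 ts ⊆ Icc 0 T)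
      (subset_univ (Metric.closedBall xs 1)))
    exact (h1.const_smul (2 * lam)).rexp.mul (hDc.pow d).continuousOn
  have hz0 : (ts, xs) ∈ Icc 0 ts ×ˢ Metric.closedBall xs 1 :=
    ⟨⟨hts.1.le, le_rfl⟩, Metric.mem_closedBall_self zero_le_one⟩
  obtain ⟨⟨t1, x1⟩, ⟨ht1, hx1⟩, hmax⟩ := (isCompact_Icc.prod (isCompact_closedBall xs 1)).exists_isMaxOn
    ⟨_, hz0⟩ hPc
  simp only at ht1 hx1
  rw [mem_closedBall_iff_norm] at hx1
  have hDs : D (ts, xs) = √(ts / T) := by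
    simp only [D, sub_self, norm_zero, sub_zero]
    apply min_eq_left
    rw [Real.sqrt_le_one, div_le_one hT]; exact hts.2
  have hDs0 : 0 < √(ts / T) := Real.sqrt_pos.2 (div_pos hts.1 hT)
  have hP := hmax hz0
  simp only [mem_ofPred_eq, hDs] at hP
  refine hP.trans ?_
  set δ := D (t1, x1) with hδ
  have hδ0 : 0 < δ := by
    have h1 : 0 ≤ δ := le_min (Real.sqrt_nonneg _) (by simpa using hx1)
    refine lt_of_le_of_ne h1 fun h => ?_
    rw [← h, zero_pow (by omega), mul_zero] at hP
    have : 0 < Real.exp (2 * lam * m ts xs) * √(ts / T) ^ d := by positivity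
    linarith
  have hδx : ‖x1 - xs‖ ≤ 1 - δ := by
    have : δ ≤ 1 - ‖x1 - xs‖ := min_le_right _ _
    linarith
  have hδt : T * δ ^ 2 ≤ t1 := by
    have : δ ≤ √(t1 / T) := min_le_left _ _
    have := (Real.le_sqrt hδ0.le (div_nonneg ht1.1 hT.le)).1 this
    rw [le_div_iff₀ hT] at this; linarith
  have hδ1 : δ ≤ 1 := by have := norm_nonneg (x1 - xs); linarith
  set s := c0 * δ ^ 2 with hs
  have hs0 : 0 < s := by positivity
  have hs1 : s ≤ 3 * T / 4 * δ ^ 2 := by rw [hs]; gcongr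
  set t0 := t1 - s with ht0
  have hδ2 : 0 < T * δ ^ 2 := by positivity
  have ht00 : T * δ ^ 2 / 4 ≤ t0 := by linarith
  have ht0p : 0 < t0 := by linarith
  have ht01 : t0 < t1 := by linarith
  have ht1T : t1 ≤ T := ht1.2.trans hts.2
  set m1 := m t1 x1 with hm1
  have hmb : ∀ t ∈ Icc t0 t1, ∀ x, ‖x - x1‖ ≤ δ / 2 → m t x ≤ m1 + b := by
    intro t ht x hx
    have hxx : ‖x - xs‖ ≤ 1 - δ / 2 := by
      have := norm_add_le (x - x1) (x1 - xs)
      rw [sub_add_sub_cancel] at this; linarith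
    have hDD : δ / 2 ≤ D (t, x) := by
      refine le_min ?_ (by simp only; linarith)
      refine Real.le_sqrt_of_sq_le ?_
      simp only
      rw [le_div_iff₀ hT]
      have := ht.1
      linarith
    have h1 := hmax (show (t, x) ∈ Icc 0 ts ×ˢ Metric.closedBall xs 1 from
      ⟨⟨ht0p.le.trans ht.1, ht.2.trans ht1.2⟩, by
        simp only [mem_closedBall_iff_norm]; linarith⟩)
    simp only [mem_ofPred_eq] at h1
    have h2 : Real.exp (2 * lam * m t x) * (δ / 2) ^ d ≤ Real.exp (2 * lam * m1) * δ ^ d :=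
      le_trans (by gcongr) h1
    rw [div_pow, mul_div_assoc', div_le_iff₀ (by positivity)] at h2
    have h3 : Real.exp (2 * lam * m t x) ≤ Real.exp (2 * lam * m1) * 2 ^ d := by
      have : 0 < δ ^ d := by positivity
      refine le_of_mul_le_mul_right ?_ this
      linarith
    have h4 : Real.exp (2 * lam * m1) * 2 ^ d = Real.exp (2 * lam * (m1 + b)) := by
      rw [mul_add, Real.exp_add, hb, mul_div_cancel₀ _ (by positivity),
        Real.exp_nat_mul, Real.exp_log (by norm_num)]
    rw [h4, Real.exp_le_exp] at h3
    exact le_of_mul_le_mul_left h3 (by positivity)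
  let χ : EuclideanSpace ℝ (Fin d) → ℝ := fun x => max 0 (min 1 (2 - ‖x - x1‖ / (δ / 4)))
  have hχc : Continuous χ := by simp only [χ]; fun_prop
  have ht0I : t0 ∈ Icc (0:ℝ) T := ⟨ht0p.le, by linarith⟩
  have hm0c := hmc t0 ht0I
  let f : EuclideanSpace ℝ (Fin d) → ℝ := fun x => Real.exp (κ * m t0 x) * χ x
  have hfc : Continuous f := by simp only [f]; fun_prop
  have hχ0 : ∀ x, 0 ≤ χ x := fun x => le_max_left _ _
  have hχ1 : ∀ x, χ x ≤ 1 := fun x => max_le zero_le_one (min_le_left _ _)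
  have hf0 : ∀ x, 0 ≤ f x := fun x => mul_nonneg (Real.exp_pos _).le (hχ0 x)
  have hfz : ∀ y, δ / 2 < ‖y - x1‖ → f y = 0 := by
    intro y hy
    have : χ y = 0 := by
      apply max_eq_left
      refine (min_le_right _ _).trans ?_
      rw [sub_nonpos, le_div_iff₀ (by positivity)]; linarith
    simp only [f, this, mul_zero]
  have hfcs : HasCompactSupport f :=
    HasCompactSupport.intro (isCompact_closedBall x1 (δ / 2)) fun y hy => hfz y (by
      rwa [mem_closedBall_iff_norm, not_le] at hy)
  have key := local_bound (κ := κ) (B := H * Real.exp (κ * m1)) (ϱ := δ / 4) hν hκ0 hκ2 ht01 x1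
    (by positivity) (hcont.mono (prod_mono (Icc_subset_Icc ht0p.le ht1T) (le_refl univ)))
    (fun t ht => hsp t ⟨ht0p.trans ht.1, ht.2.trans ht1T⟩)
    (fun x t ht => htime x t ⟨ht0p.trans ht.1, ht.2.trans ht1T⟩)
    (fun t ht => hsub t ⟨ht0p.trans ht.1, ht.2.trans ht1T⟩)
    (fun t ht x hx => by
      rw [hH, ← Real.exp_add, Real.exp_le_exp]
      have := mul_le_mul_of_nonneg_left (hmb t ht x (by linarith)) hκ0.le
      linarith) hfc hfcs hf0 (fun x hx => by
      have : χ x = 1 := by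
        simp only [χ]
        rw [min_eq_left, max_eq_right zero_le_one]
        have : ‖x - x1‖ / (δ / 4) ≤ 1 := by rw [div_le_one (by positivity)]; exact hx
        linarith
      simp only [f, this, mul_one]; exact le_rfl)
  rw [show t1 - t0 = s by rw [ht0]; ring, ← hZ, ← hm1] at key
  have hBt : H * Real.exp (κ * m1) * (2 * d * ν * s / (δ / 4) ^ 2) ≤ 1 / 2 * Real.exp (κ * m1) := by
    have : 2 * d * ν * s / (δ / 4) ^ 2 = 32 * d * ν * c0 := by
      rw [hs]; field_simp; ring
    rw [this]
    have : H * (32 * d * ν * c0) ≤ 1 / 2 := by linarith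
    have := mul_le_mul_of_nonneg_right this (Real.exp_pos (κ * m1)).le
    linarith
  have hhb := heat_bound hf0 (e := fun y => Real.exp (2 * lam * m t0 y)) (by fun_prop)
    hν hs0 (c := H * Real.exp ((κ - 2 * lam) * m1)) (r := δ / 2) x1 hfz (by
      intro y hy
      have h1 := hmb t0 ⟨le_rfl, ht01.le⟩ y hy
      have h2 : Real.exp (κ * m t0 y) ≤
          H * Real.exp ((κ - 2 * lam) * m1) * Real.exp (2 * lam * m t0 y) := by
        rw [hH, ← Real.exp_add, ← Real.exp_add, Real.exp_le_exp]
        have := mul_le_mul_of_nonneg_left h1 (sub_nonneg.2 hκ1)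
        have : 0 ≤ 2 * lam * b := by positivity
        linarith
      exact (mul_le_of_le_one_right (Real.exp_pos _).le (hχ1 y)).trans h2)
  have hball : ∫ y in Metric.closedBall x1 (δ / 2), Real.exp (2 * lam * m t0 y) ≤
      M * (2 + ‖xs‖) ^ d := by
    refine le_trans ?_ (hM t0 ht0I (2 + ‖xs‖) (by positivity))
    refine setIntegral_mono_set ?_ (ae_of_all _ fun y => (Real.exp_pos _).le) ?_
    · exact (by fun_prop : Continuous fun y => Real.exp (2 * lam * m t0 y)).continuousOn.integrableOn_compact
        (isCompact_closedBall _ _)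
    · refine LE.le.eventuallyLE fun y hy => ?_
      rw [mem_closedBall_iff_norm] at hy
      rw [mem_closedBall_zero_iff]
      have e1 := norm_add_le (y - x1) x1
      have e2 := norm_add_le (x1 - xs) xs
      rw [sub_add_cancel] at e1 e2
      linarith
  have hlogs : Real.exp (-(d/2 : ℝ) * Real.log s) = Real.exp (-(d/2 : ℝ) * Real.log c0) / δ ^ d := by
    rw [hs, Real.log_mul hc00.ne' (by positivity), Real.log_pow, mul_add, Real.exp_add,
      div_eq_mul_inv (Real.exp _) (δ ^ d)]
    congr 1
    rw [← Real.exp_log (show 0 < δ ^ d by positivity), ← Real.exp_neg, Real.log_pow]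
    congr 1; push_cast; ring
  set Q := Real.exp (-(d/2 : ℝ) * Real.log c0) with hQ
  have hQ0 : 0 < Q := Real.exp_pos _
  have h5 : Real.exp (κ * m1) ≤ 2 / Z * (Q / δ ^ d * (H * Real.exp ((κ - 2 * lam) * m1) *
      (M * (2 + ‖xs‖) ^ d))) := by
    have h6 : heat f ν s x1 ≤ Q / δ ^ d * (H * Real.exp ((κ - 2 * lam) * m1) *
      (M * (2 + ‖xs‖) ^ d)) := by
      rw [← hlogs]
      refine hhb.trans ?_
      gcongr
    have h7 := div_le_div_of_nonneg_right h6 hZ0.le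
    have : 2 / Z * (Q / δ ^ d * (H * Real.exp ((κ - 2 * lam) * m1) *
      (M * (2 + ‖xs‖) ^ d))) = 2 * ((Q / δ ^ d * (H * Real.exp ((κ - 2 * lam) * m1) *
      (M * (2 + ‖xs‖) ^ d))) / Z) := by ring
    rw [this]; linarith
  have h8 : Real.exp (κ * m1) = Real.exp (2 * lam * m1) * Real.exp ((κ - 2 * lam) * m1) := by
    rw [← Real.exp_add]; congr 1; ring
  rw [h8] at h5
  refine le_of_mul_le_mul_right ?_ (Real.exp_pos ((κ - 2 * lam) * m1))
  have hδd : 0 < δ ^ d := by positivity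
  have h9 := mul_le_mul_of_nonneg_right h5 hδd.le
  have h10 : 2 / Z * (Q / δ ^ d * (H * Real.exp ((κ - 2 * lam) * m1) *
      (M * (2 + ‖xs‖) ^ d))) * δ ^ d = 2 / Z * Q * H * M * (2 + ‖xs‖) ^ d *
        Real.exp ((κ - 2 * lam) * m1) := by
    field_simp
  rw [h10] at h9
  linarith

def rr {d : ℕ} (x : EuclideanSpace ℝ (Fin d)) : ℝ := √(1 + ‖x‖ ^ 2)

def sg (T t : ℝ) : ℝ := (t / T) ^ (1 / 8 : ℝ)

theorem one_le_rr {d : ℕ} (x : EuclideanSpace ℝ (Fin d)) : 1 ≤ rr x := by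
  rw [rr, Real.one_le_sqrt]; nlinarith [norm_nonneg x]

theorem norm_le_rr {d : ℕ} (x : EuclideanSpace ℝ (Fin d)) : ‖x‖ ≤ rr x :=
  Real.le_sqrt_of_sq_le (by linarith)

theorem rr_sq {d : ℕ} (x : EuclideanSpace ℝ (Fin d)) : rr x ^ 2 = 1 + ‖x‖ ^ 2 :=
  Real.sq_sqrt (by positivity)

theorem sg_pos {T t : ℝ} (hT : 0 < T) (ht : 0 < t) : 0 < sg T t :=
  Real.rpow_pos_of_pos (div_pos ht hT) _

theorem sg_le_one {T t : ℝ} (hT : 0 < T) (ht : 0 ≤ t) (htT : t ≤ T) : sg T t ≤ 1 :=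
  Real.rpow_le_one (div_nonneg ht hT.le) ((div_le_one hT).2 htT) (by norm_num)

theorem growth {d : ℕ} (hd : 1 ≤ d) {ν lam T : ℝ} (hν : 0 < ν) (hlam : 0 < lam) (hT : 0 < T)
    {m : ℝ → EuclideanSpace ℝ (Fin d) → ℝ}
    (hcont : ContinuousOn (fun p : ℝ × EuclideanSpace ℝ (Fin d) => m p.1 p.2) (Icc 0 T ×ˢ univ))
    (hsp : ∀ t ∈ Ioc 0 T, ContDiff ℝ 2 (m t))
    (htime : ∀ x, ∀ t ∈ Ioc 0 T, DifferentiableAt ℝ (fun s => m s x) t)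
    (hsub : ∀ t ∈ Ioc 0 T, ∀ x, deriv (fun s => m s x) t ≤
      ν * lapl (m t) x + lam * ‖gradient (m t) x‖ ^ 2)
    (hstar : (⨆ t ∈ Set.Icc (0:ℝ) T, fstar (fun y => Real.exp (2 * lam * |m t y|)) 0) < ⊤) :
    ∃ K : ℝ, 0 ≤ K ∧ ∀ t ∈ Ioc 0 T, ∀ x, m t x ≤ K * (√(rr x) + (sg T t)⁻¹) := by
  obtain ⟨C, hC⟩ := pick_bound hd hν hlam hT hcont hsp htime hsub hstar
  set C' := |C| + 1 with hC'
  have hC'0 : 0 < C' := by positivity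
  refine ⟨(C' + 5 * d) / (2 * lam), by positivity, fun t ht x => ?_⟩
  have hσ := sg_pos hT ht.1
  have hr := one_le_rr x
  have hr0 : 0 < rr x := by linarith
  have hsr : 1 ≤ √(rr x) := by rwa [Real.one_le_sqrt]
  have h1 : Real.exp (2 * lam * m t x) * √(t / T) ^ d ≤ C' * (3 * rr x) ^ d := by
    refine (hC t ht x).trans ?_
    have : C ≤ C' := by have := le_abs_self C; linarith
    have h2 : 2 + ‖x‖ ≤ 3 * rr x := by have := norm_le_rr x; linarith
    gcongr
  have hq : 0 < √(t / T) := Real.sqrt_pos.2 (div_pos ht.1 hT)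
  have h2 := Real.log_le_log (by positivity) h1
  rw [Real.log_mul (Real.exp_pos _).ne' (by positivity), Real.log_exp, Real.log_pow,
    Real.log_mul hC'0.ne' (by positivity), Real.log_pow, Real.log_mul (by norm_num) hr0.ne'] at h2
  have h3 : Real.log √(t / T) = 4 * Real.log (sg T t) := by
    rw [sg, Real.log_rpow (div_pos ht.1 hT), Real.log_sqrt (div_pos ht.1 hT).le]; ring
  have h4 : - Real.log (sg T t) ≤ (sg T t)⁻¹ := by
    rw [← Real.log_inv]; exact Real.log_le_self (by positivity)
  have h5 : Real.log (rr x) ≤ 2 * √(rr x) := by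
    have := Real.log_le_self (Real.sqrt_nonneg (rr x))
    rw [Real.log_sqrt hr0.le] at this; linarith
  have h6 : Real.log C' ≤ C' := Real.log_le_self hC'0.le
  have h7 : Real.log 3 ≤ 3 := Real.log_le_self (by norm_num)
  rw [div_mul_eq_mul_div, le_div_iff₀ (by positivity)]
  rw [h3] at h2
  have hi : 0 < (sg T t)⁻¹ := by positivity
  have hd0 : (0:ℝ) ≤ d := by positivity
  have a1 := mul_le_mul_of_nonneg_left h4 hd0
  have a2 := mul_le_mul_of_nonneg_left h5 hd0
  have a3 := mul_le_mul_of_nonneg_left h7 hd0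
  have a4 := mul_le_mul_of_nonneg_left hsr hd0
  have a5 := mul_le_mul_of_nonneg_left hsr hC'0.le
  have a6 : 0 ≤ C' * (sg T t)⁻¹ := by positivity
  have a7 : 0 ≤ d * (sg T t)⁻¹ := by positivity
  nlinarith

theorem sg_hasDeriv {T t : ℝ} (hT : 0 < T) (ht : 0 < t) :
    HasDerivAt (sg T) (1 / (8 * T * sg T t ^ 7)) t := by
  have h0 : 0 < t / T := div_pos ht hT
  have h1 := ((hasDerivAt_id t).div_const T).rpow_const (p := (1 / 8 : ℝ)) (Or.inl h0.ne')
  refine h1.congr_deriv ?_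
  have h2 : sg T t ^ 7 = (t / T) ^ (7 / 8 : ℝ) := by
    rw [sg, ← Real.rpow_natCast, ← Real.rpow_mul h0.le]; norm_num
  rw [h2, show (1 / 8 - 1 : ℝ) = -(7/8) by norm_num]
  simp only [id]
  rw [Real.rpow_neg h0.le]
  have : 0 < (t / T) ^ (7 / 8 : ℝ) := by positivity
  field_simp

theorem sg_continuous (T : ℝ) : Continuous (sg T) := by
  unfold sg
  exact (continuous_id.div_const T).rpow_const (fun _ => Or.inr (by norm_num))

theorem sg_mono {T s t : ℝ} (hT : 0 < T) (hs : 0 ≤ s) (hst : s ≤ t) : sg T s ≤ sg T t := by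
  unfold sg
  apply Real.rpow_le_rpow (by positivity) (by gcongr) (by norm_num)

theorem rr_continuous {d : ℕ} : Continuous (rr (d := d)) := by
  unfold rr; fun_prop

theorem rr_D2 {d : ℕ} (x : EuclideanSpace ℝ (Fin d)) (i : Fin d) :
    D2 (fun h : ℝ => rr (x + h • EuclideanSpace.single i (1:ℝ))) (x i / rr x)
      ((1 - (x i / rr x) ^ 2) / rr x) := by
  have hq : ∀ h : ℝ, rr (x + h • EuclideanSpace.single i (1:ℝ)) =
      √(1 + (‖x‖^2 + 2 * h * x i + h^2)) := by
    intro h; rw [rr, norm_line]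
  have hder : ∀ h : ℝ, HasDerivAt (fun h : ℝ => rr (x + h • EuclideanSpace.single i (1:ℝ)))
      ((x i + h) / rr (x + h • EuclideanSpace.single i (1:ℝ))) h := by
    intro h
    have b1 : HasDerivAt (fun h : ℝ => 1 + (‖x‖ ^ 2 + 2 * h * x i + h ^ 2))
        (2 * 1 * x i + (2:ℕ) * h ^ (2-1) * 1) h :=
        (((((hasDerivAt_id h).const_mul 2).mul_const (x i)).const_add (‖x‖ ^ 2)).add
          ((hasDerivAt_id h).pow 2)).const_add 1
    have hpos : (1 + (‖x‖ ^ 2 + 2 * h * x i + h ^ 2)) ≠ 0 := by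
      rw [← norm_line]; positivity
    have b2 := b1.sqrt hpos
    refine (b2.congr_deriv ?_).congr_of_eventuallyEq (Eventually.of_forall fun h' => hq h')
    rw [hq]
    have : √(1 + (‖x‖ ^ 2 + 2 * h * x i + h ^ 2)) ≠ 0 := by
      rw [← hq]; have := one_le_rr (x + h • EuclideanSpace.single i (1:ℝ)); linarith
    rw [show 2 * 1 * x i + ((2:ℕ):ℝ) * h ^ (2-1) * 1 = 2 * (x i + h) by norm_num; ring]
    rw [mul_div_mul_left _ _ (by norm_num)]
  have hr := one_le_rr x
  refine ⟨_, Eventually.of_forall hder, by simp, ?_⟩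
  have h1 := ((hasDerivAt_id (0:ℝ)).const_add (x i)).div (hder 0) (by
    have := one_le_rr (x + (0:ℝ) • EuclideanSpace.single i (1:ℝ)); linarith)
  refine h1.congr_deriv ?_
  have : rr x ≠ 0 := by linarith
  simp only [zero_smul, add_zero, id]
  field_simp

theorem conv_ineq {d : ℕ} {V : EuclideanSpace ℝ (Fin d) → ℝ} (hV : ConvexOn ℝ univ V)
    (hV2 : ∀ z, V z ≤ ‖z‖ ^ 2) {θ : ℝ} (hθ : 0 < θ) (p q : EuclideanSpace ℝ (Fin d)) :
    (1 + θ) * V p ≤ V q + 1 / θ * ‖(1 + θ) • p - q‖ ^ 2 := by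
  set ξ := (1 / θ) • ((1 + θ) • p - q) with hξ
  have h1 := hV.2 (mem_univ q) (mem_univ ξ) (show 0 ≤ 1 / (1 + θ) by positivity)
    (show 0 ≤ θ / (1 + θ) by positivity) (by field_simp)
  have h2 : (1 / (1 + θ)) • q + (θ / (1 + θ)) • ξ = p := by
    have e1 : θ / (1 + θ) * (1 / θ) = 1 / (1 + θ) := by field_simp
    have e2 : 1 / (1 + θ) * (1 + θ) = 1 := by field_simp
    rw [hξ, smul_smul, e1, ← smul_add, add_sub_cancel, smul_smul, e2, one_smul]
  rw [h2, smul_eq_mul, smul_eq_mul] at h1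
  have h3 := hV2 ξ
  have h4 : ‖ξ‖ ^ 2 = (1 / θ) ^ 2 * ‖(1 + θ) • p - q‖ ^ 2 := by
    rw [hξ, norm_smul, mul_pow, Real.norm_eq_abs, sq_abs]
  have h5 : (1 + θ) * V p ≤ V q + θ * V ξ := by
    have := mul_le_mul_of_nonneg_left h1 (show 0 ≤ 1 + θ by positivity)
    refine this.trans_eq ?_
    field_simp
  have h6 : θ * V ξ ≤ 1 / θ * ‖(1 + θ) • p - q‖ ^ 2 := by
    refine (mul_le_mul_of_nonneg_left (h3.trans_eq h4) hθ.le).trans_eq ?_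
    field_simp
  linarith

theorem final_ineq {ν lam T K r σ E S L U0 η dd N : ℝ} (hν : 0 < ν) (hlam : 0 < lam) (hT : 0 < T)
    (hK : 0 ≤ K) (hr : 1 ≤ r) (hσ : 0 < σ) (hσ1 : σ ≤ 1) (hE : 0 ≤ E) (hEσ : E ≤ 1 / σ ^ 2)
    (hS : S ≤ 1) (hL : L ≤ dd) (hdd : 0 ≤ dd)
    (hN : N = 1 + K * σ ^ 4)
    (hU : U0 ≤ K * (√r + σ⁻¹)) (hη : 2 + 8 * T * (ν * (1 + dd) + 2 * lam) ≤ η) :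
    ν * (N * L + E * (S / σ ^ 2 + L / σ)) + lam * ((N + E / σ) ^ 2 * S) / σ ^ 4 +
      1 / (2 * T * σ ^ 4) * U0 -
      (K * r / (2 * T * σ ^ 4) + (4 * T * (ν * dd * (1 + K) + 2 * lam * (1 + K) ^ 2 + 1) + 2 * K) /
        (4 * T * σ ^ 6) + E * (η - 2) / (8 * T * σ ^ 8)) < 0 := by
  obtain ⟨w, hw⟩ : ∃ w, w = σ⁻¹ := ⟨_, rfl⟩
  have hw1 : 1 ≤ w := by rw [hw]; exact (one_le_inv₀ hσ).2 hσ1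
  have hw0 : 0 < w := by linarith
  have hN0 : 1 ≤ N := by rw [hN]; have : 0 ≤ K * σ ^ 4 := by positivity
                         linarith
  have hNK : N ≤ 1 + K := by
    rw [hN]; have := mul_le_mul_of_nonneg_left (pow_le_one₀ (n := 4) hσ.le hσ1) hK; linarith
  have hsr : √r ≤ r := by
    rw [Real.sqrt_le_left (by linarith)]; nlinarith
  have hUr : U0 ≤ K * (r + w) := by
    rw [hw]; refine hU.trans ?_; gcongr
  have hEw : E ≤ w ^ 2 := by rw [hw, inv_pow, ← one_div]; exact hEσ
  have pw : ∀ a b : ℕ, a ≤ b → w ^ a ≤ w ^ b := fun a b h => pow_le_pow_right₀ hw1 h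
  -- term bounds
  have t1 : ν * (N * L + E * (S / σ ^ 2 + L / σ)) ≤ ν * ((1 + K) * dd) * w ^ 6 +
      ν * (1 + dd) * (E * w ^ 8) := by
    have a1 : N * L ≤ (1 + K) * dd * w ^ 6 := by
      have : N * L ≤ (1 + K) * dd := (mul_le_mul_of_nonneg_left hL (by linarith)).trans
        (mul_le_mul_of_nonneg_right hNK hdd)
      have h0 : 0 ≤ (1 + K) * dd := by positivity
      have := le_mul_of_one_le_right h0 (one_le_pow₀ hw1 (n := 6))
      linarith
    have a2 : S / σ ^ 2 + L / σ ≤ (1 + dd) * w ^ 8 := by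
      have : S / σ ^ 2 + L / σ = S * w ^ 2 + L * w := by rw [hw]; field_simp
      rw [this]
      have b1 : S * w ^ 2 ≤ 1 * w ^ 8 := by
        refine mul_le_mul hS (pw 2 8 (by norm_num)) (by positivity) (by norm_num)
      have b2 : L * w ≤ dd * w ^ 8 := by
        refine (mul_le_mul_of_nonneg_right hL hw0.le).trans ?_
        have := pw 1 8 (by norm_num)
        rw [pow_one] at this
        gcongr
      linarith
    have a3 := mul_le_mul_of_nonneg_left a2 hE
    have := mul_le_mul_of_nonneg_left (add_le_add a1 a3) hν.le
    linarith
  have t2 : lam * ((N + E / σ) ^ 2 * S) / σ ^ 4 ≤ 2 * lam * (1 + K) ^ 2 * w ^ 6 +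
      2 * lam * (E * w ^ 8) := by
    have e : lam * ((N + E / σ) ^ 2 * S) / σ ^ 4 = lam * ((N + E * w) ^ 2 * S * w ^ 4) := by
      rw [hw]; field_simp
    rw [e]
    have a1 : (N + E * w) ^ 2 * S ≤ 2 * (1 + K) ^ 2 + 2 * (E * w ^ 4) := by
      have b1 : (N + E * w) ^ 2 * S ≤ (N + E * w) ^ 2 := mul_le_of_le_one_right (by positivity) hS
      have b2 : (N + E * w) ^ 2 ≤ 2 * N ^ 2 + 2 * (E * w) ^ 2 := by nlinarith [sq_nonneg (N - E * w)]
      have b3 : N ^ 2 ≤ (1 + K) ^ 2 := by gcongr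
      have b4 : (E * w) ^ 2 ≤ E * w ^ 4 := by
        have := mul_le_mul_of_nonneg_left hEw (show 0 ≤ E * w ^ 2 by positivity)
        nlinarith
      linarith
    have a2 := mul_le_mul_of_nonneg_right a1 (show 0 ≤ w ^ 4 by positivity)
    have a3 : 2 * (1 + K) ^ 2 * w ^ 4 ≤ 2 * (1 + K) ^ 2 * w ^ 6 := by
      have := pw 4 6 (by norm_num); gcongr
    have := mul_le_mul_of_nonneg_left (a2.trans (show _ ≤ 2 * (1 + K) ^ 2 * w ^ 6 +
      2 * (E * w ^ 8) by linarith)) hlam.le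
    linarith
  have t3 : 1 / (2 * T * σ ^ 4) * U0 ≤ K * r / (2 * T * σ ^ 4) + K / (2 * T) * w ^ 6 := by
    have a1 := mul_le_mul_of_nonneg_left hUr (show 0 ≤ 1 / (2 * T * σ ^ 4) by positivity)
    have a2 : 1 / (2 * T * σ ^ 4) * (K * (r + w)) =
        K * r / (2 * T * σ ^ 4) + K / (2 * T) * w ^ 5 := by rw [hw]; field_simp
    have a3 : K / (2 * T) * w ^ 5 ≤ K / (2 * T) * w ^ 6 := by
      have := pw 5 6 (by norm_num); gcongr
    linarith
  have t4 : (4 * T * (ν * dd * (1 + K) + 2 * lam * (1 + K) ^ 2 + 1) + 2 * K) /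
        (4 * T * σ ^ 6) = (ν * dd * (1 + K) + 2 * lam * (1 + K) ^ 2 + 1) * w ^ 6 +
          K / (2 * T) * w ^ 6 := by
    rw [hw]; field_simp; ring
  have t5 : (ν * (1 + dd) + 2 * lam) * (E * w ^ 8) ≤ E * (η - 2) / (8 * T * σ ^ 8) := by
    have e : E * (η - 2) / (8 * T * σ ^ 8) = (η - 2) / (8 * T) * (E * w ^ 8) := by
      rw [hw]; field_simp
    rw [e]
    have : ν * (1 + dd) + 2 * lam ≤ (η - 2) / (8 * T) := by
      rw [le_div_iff₀ (by positivity)]; linarith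
    gcongr
  have hw6 : 0 < w ^ 6 := by positivity
  rw [t4]
  linarith

def Eb {d : ℕ} (T R c t : ℝ) (x : EuclideanSpace ℝ (Fin d)) : ℝ :=
  (sg T t ^ 2)⁻¹ * Real.exp (c - (R - rr x) / sg T t)

theorem Eb_time {d : ℕ} {T R c t : ℝ} (hT : 0 < T) (ht : 0 < t) (x : EuclideanSpace ℝ (Fin d)) :
    HasDerivAt (fun s => Eb T R c s x)
      (Eb T R c t x * ((R - rr x) / sg T t - 2) / (8 * T * sg T t ^ 8)) t := by
  have hσ := sg_pos hT ht
  have h1 := sg_hasDeriv hT ht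
  have h2 := (h1.pow 2).inv (show sg T t ^ 2 ≠ 0 by positivity)
  have h3 := (((hasDerivAt_const t (R - rr x)).div h1 hσ.ne').const_sub c).exp
  refine (h2.mul h3).congr_deriv ?_
  simp only [Eb, Pi.pow_apply, Pi.inv_apply, Pi.div_apply]
  field_simp
  norm_num
  ring

theorem Eb_space {d : ℕ} {T R c t : ℝ} (x : EuclideanSpace ℝ (Fin d)) (i : Fin d) :
    D2 (fun h : ℝ => Eb T R c t (x + h • EuclideanSpace.single i (1:ℝ)))
      (Eb T R c t x * (x i / rr x / sg T t))
      (Eb T R c t x * ((x i / rr x) ^ 2 / sg T t ^ 2 + (1 - (x i / rr x) ^ 2) / rr x / sg T t)) := by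
  have h1 := (((D2.const (c - R / sg T t)).add ((rr_D2 x i).const_mul (1 / sg T t))).exp).const_mul
    (sg T t ^ 2)⁻¹
  have h2 : (fun h : ℝ => Eb T R c t (x + h • EuclideanSpace.single i (1:ℝ))) = fun h =>
      (sg T t ^ 2)⁻¹ * Real.exp (c - R / sg T t + 1 / sg T t *
        rr (x + h • EuclideanSpace.single i (1:ℝ))) := by
    funext h; rw [Eb]; congr 2; ring
  have h3 : Real.exp (c - (R - rr x) / sg T t) = Real.exp (c - R / sg T t + 1 / sg T t * rr x) := by
    congr 1; ring
  rw [h2]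
  convert h1 using 1
  · simp only [zero_smul, add_zero]
    rw [Eb, h3]; ring
  · simp only [zero_smul, add_zero]
    rw [Eb, h3]; ring

theorem exists_max {d : ℕ} {T R c : ℝ} (hT : 0 < T) (hc0 : 0 < c)
    {F1 G : ℝ → EuclideanSpace ℝ (Fin d) → ℝ}
    (hF1c : ContinuousOn (fun p : ℝ × EuclideanSpace ℝ (Fin d) => F1 p.1 p.2)
      (Set.Icc 0 T ×ˢ Set.univ))
    (hGc : ContinuousOn (fun p : ℝ × EuclideanSpace ℝ (Fin d) => G p.1 p.2)
      (Set.Ioi 0 ×ˢ Set.univ))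
    (hG0 : ∀ t, 0 < t → ∀ x, 0 ≤ G t x) (h0 : ∀ x, F1 0 x < 0)
    {ta : ℝ} (hta : ta ∈ Ioc 0 T) {xa : EuclideanSpace ℝ (Fin d)} (hxa : rr xa ≤ R - c * sg T ta)
    (hFa : 0 < F1 ta xa - G ta xa) :
    ∃ t ∈ Ioc 0 T, ∃ x, rr x ≤ R - c * sg T t ∧ 0 < F1 t x - G t x ∧
      ∀ s ∈ Ioc 0 T, ∀ y, rr y ≤ R - c * sg T s → F1 s y - G s y ≤ F1 t x - G t x := by
  have hsgc := sg_continuous T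
  have hrrc := rr_continuous (d := d)
  obtain ⟨S3, hS3, hS3m⟩ : ∃ S3 : Set (ℝ × EuclideanSpace ℝ (Fin d)), IsCompact S3 ∧
      ∀ p, p ∈ S3 ↔ ((p.1 ∈ Icc 0 T ∧ ‖p.2‖ ≤ R) ∧ rr p.2 ≤ R - c * sg T p.1) ∧ 0 ≤ F1 p.1 p.2 := by
    have hS1 : IsCompact (Icc 0 T ×ˢ Metric.closedBall (0 : EuclideanSpace ℝ (Fin d)) R) :=
      isCompact_Icc.prod (isCompact_closedBall 0 R)
    have hS2 : IsClosed ((Icc 0 T ×ˢ Metric.closedBall (0 : EuclideanSpace ℝ (Fin d)) R) ∩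
        {p | rr p.2 ≤ R - c * sg T p.1}) :=
      hS1.isClosed.inter (isClosed_le (by fun_prop) (by fun_prop))
    refine ⟨_, hS1.of_isClosed_subset (ContinuousOn.preimage_isClosed_of_isClosed
      (hF1c.mono (fun p hp => ⟨hp.1.1, mem_univ _⟩)) hS2 (isClosed_Ici (a := (0:ℝ))))
      (inter_subset_left.trans inter_subset_left), fun p => ?_⟩
    simp [Set.mem_prod]
  have hmem : ∀ t ∈ Ioc 0 T, ∀ x, rr x ≤ R - c * sg T t → 0 ≤ F1 t x → (t, x) ∈ S3 := by
    intro t ht x hx hF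
    refine (hS3m _).2 ⟨⟨⟨⟨ht.1.le, ht.2⟩, ?_⟩, hx⟩, hF⟩
    have h1 := norm_le_rr x
    have h2 := mul_pos hc0 (sg_pos hT ht.1)
    simp only
    linarith
  have hpos : ∀ p ∈ S3, 0 < p.1 := by
    intro p hp
    have hp' := (hS3m p).1 hp
    refine lt_of_le_of_ne hp'.1.1.1.1 fun h => ?_
    have h1 : 0 ≤ F1 p.1 p.2 := hp'.2
    rw [← h] at h1
    exact absurd (h0 p.2) (not_lt.2 h1)
  have hFc : ContinuousOn (fun p : ℝ × EuclideanSpace ℝ (Fin d) => F1 p.1 p.2 - G p.1 p.2) S3 :=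
    (hF1c.mono fun p hp => ⟨((hS3m p).1 hp).1.1.1, mem_univ _⟩).sub
      (hGc.mono fun p hp => ⟨hpos p hp, mem_univ _⟩)
  have hza : (ta, xa) ∈ S3 := hmem ta hta xa hxa (by
    have := hG0 ta hta.1 xa
    linarith)
  obtain ⟨⟨t, x⟩, hz, hmax⟩ := hS3.exists_isMaxOn ⟨_, hza⟩ hFc
  have hmx := isMaxOn_iff.1 hmax
  have hz' := (hS3m _).1 hz
  have h1 := hmx _ hza
  simp only at h1 hz'
  have hFz := lt_of_lt_of_le hFa h1
  refine ⟨t, ⟨hpos _ hz, hz'.1.1.1.2⟩, x, hz'.1.2, hFz, fun s hs y hy => ?_⟩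
  by_cases h : 0 ≤ F1 s y
  · exact hmx _ (hmem s hs y hy h)
  · have := hG0 s hs.1 y
    linarith

set_option maxHeartbeats 400000 in
theorem stepA {d : ℕ} {V : EuclideanSpace ℝ (Fin d) → ℝ} (hV : ConvexOn ℝ univ V)
    (hV2 : ∀ z, V z ≤ ‖z‖ ^ 2)
    {ν lam T : ℝ} (hν : 0 < ν) (hlam : 0 < lam) (hT : 0 < T)
    {U Ubar : ℝ → EuclideanSpace ℝ (Fin d) → ℝ}
    (hUcont : ContinuousOn (fun p : ℝ × EuclideanSpace ℝ (Fin d) => U p.1 p.2)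
      (Set.Icc 0 T ×ˢ Set.univ))
    (hUbarcont : ContinuousOn (fun p : ℝ × EuclideanSpace ℝ (Fin d) => Ubar p.1 p.2)
      (Set.Icc 0 T ×ˢ Set.univ))
    (hUspace : ∀ t ∈ Set.Ioc (0:ℝ) T, ContDiff ℝ 2 (U t))
    (hUbarspace : ∀ t ∈ Set.Ioc (0:ℝ) T, ContDiff ℝ 2 (Ubar t))
    (hUtime : ∀ (x : EuclideanSpace ℝ (Fin d)), ∀ t ∈ Set.Ioc (0:ℝ) T,
      DifferentiableAt ℝ (fun s => U s x) t)
    (hUbartime : ∀ (x : EuclideanSpace ℝ (Fin d)), ∀ t ∈ Set.Ioc (0:ℝ) T,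
      DifferentiableAt ℝ (fun s => Ubar s x) t)
    (hUsub : ∀ t ∈ Set.Ioc (0:ℝ) T, ∀ x,
      deriv (fun s => U s x) t ≤ ν * lapl (U t) x + lam * V (gradient (U t) x))
    (hUbarsuper : ∀ t ∈ Set.Ioc (0:ℝ) T, ∀ x,
      ν * lapl (Ubar t) x + lam * V (gradient (Ubar t) x) ≤ deriv (fun s => Ubar s x) t)
    (hinit : ∀ x, U 0 x ≤ Ubar 0 x) {K : ℝ} (hK : 0 ≤ K)
    (hUK : ∀ t ∈ Ioc 0 T, ∀ x, U t x ≤ K * (√(rr x) + (sg T t)⁻¹))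
    (hUbK : ∀ t ∈ Ioc 0 T, ∀ x, - Ubar t x ≤ K * (√(rr x) + (sg T t)⁻¹))
    {c C1 : ℝ} (hc : c = 2 + 8 * T * (ν * (1 + d) + 2 * lam))
    (hC1 : C1 = 4 * T * (ν * d * (1 + K) + 2 * lam * (1 + K) ^ 2 + 1) + 2 * K)
    {ε R : ℝ} (hε : 0 < ε) (hε1 : ε ≤ 1) (hR : 6 * K ≤ ε * √(R - c)) :
    ∀ t ∈ Ioc 0 T, ∀ x, rr x ≤ R - c * sg T t →
      (1 + ε * sg T t ^ 4) * U t x - Ubar t x - ε * ((1 + K * sg T t ^ 4) * rr x + C1 * sg T t ^ 2)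
        - ε * Eb T R c t x ≤ 0 := by
  have hc0 : 0 < c := by rw [hc]; positivity
  have hC10 : 0 < C1 := by rw [hC1]; positivity
  have hE0 : ∀ t, 0 < t → ∀ x : EuclideanSpace ℝ (Fin d), 0 < Eb T R c t x := fun t ht x => by
    have := sg_pos hT ht
    unfold Eb; positivity
  intro ta hta xa hxa
  by_contra hcon
  push Not at hcon
  have hsgc := sg_continuous T
  have hrrc := rr_continuous (d := d)
  obtain ⟨t, htI, x, hrx, hFz, hmax'⟩ := exists_max (R := R) (F1 := fun t x =>
      (1 + ε * sg T t ^ 4) * U t x - Ubar t x -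
        ε * ((1 + K * sg T t ^ 4) * rr x + C1 * sg T t ^ 2))
      (G := fun t x => ε * Eb T R c t x) hT hc0 (by
    have e1 : Continuous (fun p : ℝ × EuclideanSpace ℝ (Fin d) => (1 + ε * sg T p.1 ^ 4)) := by
      fun_prop
    have e2 : Continuous (fun p : ℝ × EuclideanSpace ℝ (Fin d) =>
        ε * ((1 + K * sg T p.1 ^ 4) * rr p.2 + C1 * sg T p.1 ^ 2)) := by
      fun_prop
    exact ((e1.continuousOn.mul hUcont).sub hUbarcont).sub e2.continuousOn) (by
    refine continuousOn_const.mul ?_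
    unfold Eb
    have hne : ∀ p ∈ (Ioi 0 ×ˢ univ : Set (ℝ × EuclideanSpace ℝ (Fin d))), sg T p.1 ≠ 0 :=
      fun p hp => (sg_pos hT hp.1).ne'
    have k1 : Continuous (fun p : ℝ × EuclideanSpace ℝ (Fin d) => sg T p.1) := by fun_prop
    have k2 : Continuous (fun p : ℝ × EuclideanSpace ℝ (Fin d) => R - rr p.2) := by fun_prop
    refine ContinuousOn.mul ((k1.continuousOn.pow 2).inv₀ fun p hp => pow_ne_zero 2 (hne p hp)) ?_
    exact (continuousOn_const.sub (k2.continuousOn.div k1.continuousOn hne)).rexp)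
    (fun t ht x => (mul_pos hε (hE0 t ht x)).le) (by
    intro y
    have h2 : sg T 0 = 0 := by rw [sg, zero_div, Real.zero_rpow (by norm_num)]
    have h3 := hinit y
    have h4 := mul_le_mul_of_nonneg_left (one_le_rr y) hε.le
    simp only [h2]
    norm_num
    linarith) hta hxa hcon
  obtain ⟨F, hF⟩ : ∃ F : ℝ → EuclideanSpace ℝ (Fin d) → ℝ, F = fun t x =>
      (1 + ε * sg T t ^ 4) * U t x - Ubar t x -
        ε * ((1 + K * sg T t ^ 4) * rr x + C1 * sg T t ^ 2) - ε * Eb T R c t x := ⟨_, rfl⟩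
  have hmax'' : ∀ s ∈ Ioc 0 T, ∀ y, rr y ≤ R - c * sg T s → F s y ≤ F t x := by
    rw [hF]; exact hmax'
  clear hmax'
  have hσ := sg_pos hT htI.1
  have hσ1 := sg_le_one hT htI.1.le htI.2
  have hr1 := one_le_rr x
  have hU1 := hUK t htI x
  have hU2 := hUbK t htI x
  set σ := sg T t with hσdef
  set r := rr x with hrdef
  have hA0 : 0 < σ ^ 4 := by positivity
  have hA1 : σ ^ 4 ≤ 1 := pow_le_one₀ hσ.le hσ1
  -- lateral
  have hlat : r < R - c * σ := by
    refine lt_of_le_of_ne hrx fun he => ?_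
    have e1 : Eb T R c t x = (σ ^ 2)⁻¹ := by
      rw [Eb, ← hσdef, ← hrdef, show R - r = c * σ by rw [he]; ring, mul_div_assoc, div_self hσ.ne']
      simp
    have e2 : 6 * K ≤ ε * √r := by
      refine hR.trans ?_
      have : R - c ≤ r := by
        have := mul_le_mul_of_nonneg_left hσ1 hc0.le
        rw [he]; linarith
      gcongr
    obtain ⟨w, hw⟩ : ∃ w, w = σ⁻¹ := ⟨_, rfl⟩
    have hw0 : 0 < w := by rw [hw]; positivity
    obtain ⟨y, hy⟩ : ∃ y, y = √r := ⟨_, rfl⟩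
    have hy0 : 0 < y := by rw [hy]; exact Real.sqrt_pos.2 (by linarith)
    have hyr : r = y ^ 2 := by rw [hy, Real.sq_sqrt (by linarith)]
    rw [← hy] at e2
    rw [← hw, ← hy] at hU1 hU2
    have e3 : (1 + ε * σ ^ 4) * U t x ≤ 2 * (K * (y + w)) := by
      have k1 : 1 + ε * σ ^ 4 ≤ 2 := by
        have := mul_le_mul hε1 hA1 hA0.le zero_le_one; linarith
      have k2 : 0 ≤ K * (y + w) := by positivity
      have k3 : 0 ≤ 1 + ε * σ ^ 4 := by positivity
      exact (mul_le_mul_of_nonneg_left hU1 k3).trans (mul_le_mul_of_nonneg_right k1 k2)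
    have e4 : 0 ≤ ε * (K * σ ^ 4 * r + C1 * σ ^ 2) := by positivity
    have e5 : 3 * (K * (y + w)) ≤ ε * (y ^ 2 + w ^ 2) := by
      rcases le_total w y with h | h
      · have m1 := mul_le_mul_of_nonneg_right e2 hy0.le
        have m2 := mul_le_mul_of_nonneg_left h hK
        have m3 : 0 ≤ ε * w ^ 2 := by positivity
        nlinarith
      · have m1 := mul_le_mul_of_nonneg_right (e2.trans (mul_le_mul_of_nonneg_left h hε.le)) hw0.le
        have m2 := mul_le_mul_of_nonneg_left h hK
        have m3 : 0 ≤ ε * y ^ 2 := by positivity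
        nlinarith
    rw [e1, ← inv_pow, ← hw] at hFz
    rw [hyr] at hFz e4
    linarith
  -- time derivative
  have hdU := (hUtime x t htI).hasDerivAt
  have hdUb := (hUbartime x t htI).hasDerivAt
  have hdσ := sg_hasDeriv hT htI.1
  rw [← hσdef] at hdσ
  set Ut := deriv (fun s => U s x) t with hUt
  set Ubt := deriv (fun s => Ubar s x) t with hUbt
  set E := Eb T R c t x with hE
  set η := (R - r) / σ with hη
  have hFt : HasDerivAt (fun s => F s x) (ε * (1 / (2 * T * σ ^ 4)) * U t x +
      (1 + ε * σ ^ 4) * Ut - Ubt - ε * (K * r / (2 * T * σ ^ 4) + C1 / (4 * T * σ ^ 6) +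
        E * (η - 2) / (8 * T * σ ^ 8))) t := by
    rw [hF]
    have a1 := ((((hdσ.pow 4).const_mul ε).const_add 1).mul hdU).sub hdUb
    have a2 := ((((((hdσ.pow 4).const_mul K).const_add 1).mul_const r).add
      ((hdσ.pow 2).const_mul C1)).const_mul ε)
    have a3 := (Eb_time (R := R) (c := c) hT htI.1 x).const_mul ε
    refine ((a1.sub a2).sub a3).congr_deriv ?_
    simp only [← hσdef, ← hrdef, ← hE, ← hη, Pi.pow_apply]
    field_simp
    norm_num
    ring
  have htouch := time_touch hFt (by
    have : Ioo 0 t ∈ 𝓝[<] t := Ioo_mem_nhdsLT htI.1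
    filter_upwards [this] with s hs
    refine hmax'' s ⟨hs.1, hs.2.le.trans htI.2⟩ x ?_
    have := mul_le_mul_of_nonneg_left (sg_mono hT hs.1.le hs.2.le) hc0.le
    rw [← hσdef] at this
    linarith)
  have hloc : IsLocalMax (F t) x := by
    have : {y | rr y < R - c * σ} ∈ 𝓝 x :=
      (isOpen_lt hrrc continuous_const).mem_nhds hlat
    filter_upwards [this] with y hy
    exact hmax'' t htI y (le_of_lt hy)
  set N := 1 + K * σ ^ 4 with hN
  set a := 1 + ε * σ ^ 4 with ha
  set p := gradient (U t) x with hp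
  set q := gradient (Ubar t) x with hq
  set lu : Fin d → ℝ := fun i => iteratedFDeriv ℝ 2 (U t) x
    ![EuclideanSpace.single i (1:ℝ), EuclideanSpace.single i (1:ℝ)] with hlu
  set lb : Fin d → ℝ := fun i => iteratedFDeriv ℝ 2 (Ubar t) x
    ![EuclideanSpace.single i (1:ℝ), EuclideanSpace.single i (1:ℝ)] with hlb
  have hcoord : ∀ i, a * p i - q i = ε * ((N + E / σ) * (x i / r)) ∧
      a * lu i - lb i - ε * (N * ((1 - (x i / r) ^ 2) / r) +
        E * ((x i / r) ^ 2 / σ ^ 2 + (1 - (x i / r) ^ 2) / r / σ)) ≤ 0 := by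
    intro i
    have c1 := ((D2_of_contDiff (hUspace t htI) x i).const_mul a).sub
      (D2_of_contDiff (hUbarspace t htI) x i)
    have c2 := (((rr_D2 x i).const_mul N).add (D2.const (C1 * σ ^ 2))).const_mul ε
    have c3 := (Eb_space (T := T) (R := R) (c := c) (t := t) x i).const_mul ε
    rw [hF] at hloc
    have c4 := localMax_line hloc (EuclideanSpace.single i (1:ℝ))
    have c6 := ((c1.sub c2).sub c3).max c4
    rw [← hσdef, ← hrdef, ← hE, ← hp, ← hq] at c6
    refine ⟨?_, ?_⟩
    · linear_combination c6.1
    · refine le_trans (le_of_eq ?_) c6.2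
      simp only [lu, lb]; ring
  have hsum := Finset.sum_nonpos (s := Finset.univ) (fun i _ => (hcoord i).2)
  set Sx := ∑ i, (x i / r) ^ 2 with hSx
  set L := ∑ i, (1 - (x i / r) ^ 2) / r with hL
  have hr0 : 0 < r := by linarith
  have hsum' : a * (∑ i, lu i) - (∑ i, lb i) - ε * (N * L + E * (Sx / σ ^ 2 + L / σ)) ≤ 0 := by
    refine le_trans (le_of_eq ?_) hsum
    simp only [hSx, hL, Finset.sum_sub_distrib, Finset.sum_add_distrib, ← Finset.mul_sum,
      ← Finset.sum_div]
  have hSx1 : Sx ≤ 1 := by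
    have : Sx = ‖x‖ ^ 2 / r ^ 2 := by
      rw [hSx, EuclideanSpace.real_norm_sq_eq, Finset.sum_div]
      simp only [div_pow]
    rw [this, div_le_one (by positivity), hrdef, rr_sq]; linarith
  have hLd : L ≤ d := by
    have : L ≤ ∑ i : Fin d, (1:ℝ) := by
      refine Finset.sum_le_sum fun i _ => ?_
      rw [div_le_one hr0]
      have := sq_nonneg (x i / r)
      linarith
    simpa using this
  have hEσ : E ≤ 1 / σ ^ 2 := by
    have : Real.exp (c - η) ≤ 1 := by
      rw [Real.exp_le_one_iff, sub_nonpos, hη, le_div_iff₀ hσ]; linarith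
    have h2 : 0 ≤ (σ ^ 2)⁻¹ := by positivity
    rw [one_div]
    exact mul_le_of_le_one_right h2 this
  have hηc : c ≤ η := by rw [hη, le_div_iff₀ hσ]; linarith
  have hfin := final_ineq (N := N) (η := η) hν hlam hT hK hr1 hσ hσ1 (hE0 t htI.1 x).le hEσ hSx1 hLd
    (Nat.cast_nonneg d) hN hU1 (by rw [← hc]; exact hηc)
  rw [← hC1, ← hE] at hfin
  have hθ : 0 < ε * σ ^ 4 := by positivity
  have hconv := conv_ineq hV hV2 hθ p q
  have hnorm : ‖a • p - q‖ ^ 2 = ε ^ 2 * ((N + E / σ) ^ 2 * Sx) := by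
    rw [EuclideanSpace.real_norm_sq_eq, hSx, Finset.mul_sum, Finset.mul_sum]
    refine Finset.sum_congr rfl fun i _ => ?_
    have : (a • p - q) i = a * p i - q i := by simp
    rw [this, (hcoord i).1]; ring
  rw [← ha, hnorm] at hconv
  have hconv' : a * V p ≤ V q + ε * ((N + E / σ) ^ 2 * Sx / σ ^ 4) := by
    refine hconv.trans_eq ?_
    field_simp
  have hs1 := hUsub t htI x
  have hs2 := hUbarsuper t htI x
  rw [← hUt, ← hp, show lapl (U t) x = ∑ i, lu i from rfl] at hs1
  rw [← hUbt, ← hq, show lapl (Ubar t) x = ∑ i, lb i from rfl] at hs2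
  have ha0 : 0 ≤ a := by rw [ha]; positivity
  have f1 := mul_le_mul_of_nonneg_left hs1 ha0
  have f2 := mul_le_mul_of_nonneg_left hconv' hlam.le
  have f3 := mul_le_mul_of_nonneg_left hsum' hν.le
  have f4 := mul_neg_of_pos_of_neg hε hfin
  have f5 : lam * ((N + E / σ) ^ 2 * Sx) / σ ^ 4 = lam * ((N + E / σ) ^ 2 * Sx / σ ^ 4) := by ring
  rw [f5] at f4
  linarith

theorem lapl_neg {d : ℕ} (f : EuclideanSpace ℝ (Fin d) → ℝ) (x : EuclideanSpace ℝ (Fin d)) :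
    lapl (fun y => - f y) x = - lapl f x := by
  unfold lapl
  rw [← Finset.sum_neg_distrib]
  refine Finset.sum_congr rfl fun i _ => ?_
  have : (fun y => - f y) = -f := rfl
  rw [this, iteratedFDeriv_neg_apply]
  rfl

/-- Comparison principle for the KPZ equation with unbounded data (classical
version): if `U̲` is a classical subsolution and `Ū` a classical supersolution of
`∂ₜu = νΔu + λV(∇u)` with `U̲(0,·) ≤ Ū(0,·)` and
`sup_{t∈[0,T]} (e^{2λ|U̲(t,·)|})*(x) < ∞`, `sup_{t∈[0,T]} (e^{2λ|Ū(t,·)|})*(x) < ∞` for every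
`x`, then `U̲ ≤ Ū` on `[0,T] × ℝ^d`. -/
theorem statement15 {d : ℕ} (hd : 1 ≤ d)
    (V : EuclideanSpace ℝ (Fin d) → ℝ) (W : ℝ → ℝ) (hV : IsDepositionRate d V W)
    (ν lam T : ℝ) (hν : 0 < ν) (hlam : 0 < lam) (hT : 0 < T)
    (U Ubar : ℝ → EuclideanSpace ℝ (Fin d) → ℝ)
    (hUcont : ContinuousOn (fun p : ℝ × EuclideanSpace ℝ (Fin d) => U p.1 p.2)
      (Set.Icc 0 T ×ˢ Set.univ))
    (hUbarcont : ContinuousOn (fun p : ℝ × EuclideanSpace ℝ (Fin d) => Ubar p.1 p.2)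
      (Set.Icc 0 T ×ˢ Set.univ))
    (hUspace : ∀ t ∈ Set.Ioc (0:ℝ) T, ContDiff ℝ 2 (U t))
    (hUbarspace : ∀ t ∈ Set.Ioc (0:ℝ) T, ContDiff ℝ 2 (Ubar t))
    (hUtime : ∀ (x : EuclideanSpace ℝ (Fin d)), ∀ t ∈ Set.Ioc (0:ℝ) T,
      DifferentiableAt ℝ (fun s => U s x) t)
    (hUbartime : ∀ (x : EuclideanSpace ℝ (Fin d)), ∀ t ∈ Set.Ioc (0:ℝ) T,
      DifferentiableAt ℝ (fun s => Ubar s x) t)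
    (hUsub : ∀ t ∈ Set.Ioc (0:ℝ) T, ∀ x,
      deriv (fun s => U s x) t ≤ ν * lapl (U t) x + lam * V (gradient (U t) x))
    (hUbarsuper : ∀ t ∈ Set.Ioc (0:ℝ) T, ∀ x,
      ν * lapl (Ubar t) x + lam * V (gradient (Ubar t) x) ≤ deriv (fun s => Ubar s x) t)
    (hinit : ∀ x, U 0 x ≤ Ubar 0 x)
    (hUstar : ∀ x,
      (⨆ t ∈ Set.Icc (0:ℝ) T, fstar (fun y => Real.exp (2 * lam * |U t y|)) x) < ⊤)
    (hUbarstar : ∀ x,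
      (⨆ t ∈ Set.Icc (0:ℝ) T, fstar (fun y => Real.exp (2 * lam * |Ubar t y|)) x) < ⊤) :
    ∀ t ∈ Set.Icc (0:ℝ) T, ∀ x, U t x ≤ Ubar t x := by
  have hV2 : ∀ z, V z ≤ ‖z‖ ^ 2 := fun z => by
    rw [hV.isotropic]; exact hV.quadGrowth _ (norm_nonneg _)
  have hV0 : ∀ z, 0 ≤ V z := fun z => by
    rw [hV.isotropic]; exact hV.nonneg _ (norm_nonneg _)
  obtain ⟨K1, hK1, hUK1⟩ := growth hd hν hlam hT hUcont hUspace hUtime (fun t ht x => by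
    have h1 := hUsub t ht x
    have h2 := mul_le_mul_of_nonneg_left (hV2 (gradient (U t) x)) hlam.le
    linarith) (hUstar 0)
  obtain ⟨K2, hK2, hUK2⟩ := growth (m := fun t x => - Ubar t x) hd hν hlam hT hUbarcont.neg
    (fun t ht => (hUbarspace t ht).neg) (fun x t ht => (hUbartime x t ht).neg) (fun t ht x => by
    have h1 := hUbarsuper t ht x
    have h2 := mul_nonneg hlam.le (hV0 (gradient (Ubar t) x))
    have h3 : 0 ≤ lam * ‖gradient (fun y => - Ubar t y) x‖ ^ 2 := by positivity
    have h4 : deriv (fun s => - Ubar s x) t = - deriv (fun s => Ubar s x) t :=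
      (hUbartime x t ht).hasDerivAt.neg.deriv
    rw [h4, lapl_neg]
    linarith) (by simpa only [abs_neg] using hUbarstar 0)
  set K := max K1 K2 with hK
  have hK0 : 0 ≤ K := hK1.trans (le_max_left _ _)
  intro t ht x
  rcases ht.1.eq_or_lt with h0 | h0
  · rw [← h0]; exact hinit x
  have htI : t ∈ Ioc 0 T := ⟨h0, ht.2⟩
  by_contra hcon
  push Not at hcon
  have hpp : ∀ t ∈ Ioc 0 T, ∀ x : EuclideanSpace ℝ (Fin d), 0 ≤ √(rr x) + (sg T t)⁻¹ := by
    intro t ht x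
    have := sg_pos hT ht.1
    positivity
  have hA := fun ε R hε hε1 hR => stepA hV.convex hV2 hν hlam hT hUcont hUbarcont hUspace hUbarspace
    hUtime hUbartime hUsub hUbarsuper hinit hK0
    (fun t ht x => (hUK1 t ht x).trans (mul_le_mul_of_nonneg_right (le_max_left _ _) (hpp t ht x)))
    (fun t ht x => (hUK2 t ht x).trans (mul_le_mul_of_nonneg_right (le_max_right _ _) (hpp t ht x)))
    rfl rfl (ε := ε) (R := R) hε hε1 hR t htI x
  obtain ⟨c, hc⟩ : ∃ c, c = 2 + 8 * T * (ν * (1 + d) + 2 * lam) := ⟨_, rfl⟩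
  obtain ⟨C1, hC1⟩ : ∃ C1, C1 = 4 * T * (ν * d * (1 + K) + 2 * lam * (1 + K) ^ 2 + 1) + 2 * K :=
    ⟨_, rfl⟩
  simp only [← hc, ← hC1] at hA
  have hc0 : 0 < c := by rw [hc]; positivity
  have hσ := sg_pos hT h0
  have hσ1 := sg_le_one hT h0.le ht.2
  set σ := sg T t with hσdef
  have hr1 := one_le_rr x
  set Q := |(1 + K * σ ^ 4) * rr x + C1 * σ ^ 2 + 1 - σ ^ 4 * U t x| + 1 with hQ
  have hQ0 : 0 < Q := by positivity
  have hQ1 : (1 + K * σ ^ 4) * rr x + C1 * σ ^ 2 + 1 - σ ^ 4 * U t x ≤ Q := by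
    rw [hQ]; linarith [le_abs_self ((1 + K * σ ^ 4) * rr x + C1 * σ ^ 2 + 1 - σ ^ 4 * U t x)]
  have hω : 0 < U t x - Ubar t x := by linarith
  obtain ⟨ε, hε⟩ : ∃ ε, ε = min 1 ((U t x - Ubar t x) / (2 * Q)) := ⟨_, rfl⟩
  have hε0 : 0 < ε := by rw [hε]; exact lt_min zero_lt_one (by positivity)
  have hε1 : ε ≤ 1 := by rw [hε]; exact min_le_left _ _
  have hε2 : ε * (2 * Q) ≤ U t x - Ubar t x := by
    rw [← le_div_iff₀ (by positivity), hε]; exact min_le_right _ _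
  obtain ⟨R, hR⟩ : ∃ R, R = rr x + c * σ + σ * (σ ^ 2)⁻¹ + c + (6 * K / ε) ^ 2 := ⟨_, rfl⟩
  have p1 : 0 < c * σ := by positivity
  have p2 : 0 < σ * (σ ^ 2)⁻¹ := by positivity
  have p3 : 0 ≤ (6 * K / ε) ^ 2 := by positivity
  have hRc : 6 * K ≤ ε * √(R - c) := by
    have : 6 * K / ε ≤ √(R - c) := Real.le_sqrt_of_sq_le (by rw [hR]; linarith)
    rw [div_le_iff₀ hε0] at this; linarith
  have hF := hA ε R hε0 hε1 hRc (by rw [hR]; linarith)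
  have hE : Eb T R c t x ≤ 1 := by
    rw [Eb, ← hσdef]
    have h1 : c + (σ ^ 2)⁻¹ ≤ (R - rr x) / σ := by
      rw [le_div_iff₀ hσ, hR]; linarith
    have h2 : Real.exp (c - (R - rr x) / σ) ≤ Real.exp (-(σ ^ 2)⁻¹) :=
      Real.exp_le_exp.2 (by linarith)
    have h3 := Real.add_one_le_exp ((σ ^ 2)⁻¹)
    have h4 : 0 < (σ ^ 2)⁻¹ := by positivity
    calc _ ≤ Real.exp ((σ ^ 2)⁻¹) * Real.exp (-(σ ^ 2)⁻¹) := by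
          apply mul_le_mul (by linarith) h2 (Real.exp_pos _).le (Real.exp_pos _).le
      _ = 1 := by rw [← Real.exp_add]; simp
  have hE' := mul_le_mul_of_nonneg_left hE hε0.le
  have hQ2 := mul_le_mul_of_nonneg_left hQ1 hε0.le
  nlinarith
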